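/- (Brusotti theorem.) Let P_0 be a polynomial with Newton polytope Delta whose curve {P_0=0} has exactly N nondegenerate double points t_1, ..., t_N in (C*)^2 and no other singular points. For each h, let B'_h be the germ at P_0 of the smooth codimension-1 analytic submanifold of P(Delta) consisting of polynomials having a singular point in a neighborhood of t_h. Then there exists a neighborhood U' of P_0 in P(Delta) such that the intersection B'_1 cap ... cap B'_N cap U' is transversal in P(Delta). -/

import Mathlib

open MvPolynomial

/-- The coefficient space of polynomials with monomials in the finite lattice set `L`:
this is the space `P(Δ)` of polynomials with Newton polytope (contained in) `Δ`,
coordinatized by coefficients. -/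
abbrev Coef (L : Finset (ℕ × ℕ)) : Type := {p : ℕ × ℕ // p ∈ L} → ℂ

/-- The polynomial with coefficient vector `c`. -/
noncomputable def toPoly {L : Finset (ℕ × ℕ)} (c : Coef L) : MvPolynomial (Fin 2) ℂ :=
  ∑ p : {p : ℕ × ℕ // p ∈ L},
    monomial (Finsupp.single 0 p.1.1 + Finsupp.single 1 p.1.2) (c p)

/-- `z ∈ (ℂ*)²` is a singular point of the curve `{f = 0}`. -/
def IsSingAt (f : MvPolynomial (Fin 2) ℂ) (z : Fin 2 → ℂ) : Prop :=
  z 0 ≠ 0 ∧ z 1 ≠ 0 ∧ eval z f = 0 ∧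
    eval z (pderiv 0 f) = 0 ∧ eval z (pderiv 1 f) = 0

/-- `z ∈ (ℂ*)²` is a nondegenerate double point (ordinary quadratic point, node)
of the curve `{f = 0}`. -/
def IsNodeAt (f : MvPolynomial (Fin 2) ℂ) (z : Fin 2 → ℂ) : Prop :=
  IsSingAt f z ∧
    eval z (pderiv 0 (pderiv 0 f)) * eval z (pderiv 1 (pderiv 1 f)) -
      eval z (pderiv 0 (pderiv 1 f)) * eval z (pderiv 1 (pderiv 0 f)) ≠ 0

def toR (p : ℕ × ℕ) : ℝ × ℝ := ((p.1 : ℝ), (p.2 : ℝ))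

/-- The convex hull of the lattice set `L`. -/
def hullOf (L : Finset (ℕ × ℕ)) : Set (ℝ × ℝ) := convexHull ℝ (toR '' L)

/-- `L` is exactly the set of lattice points of the integer convex polytope `conv L`. -/
def IsLatticePolytopeSet (L : Finset (ℕ × ℕ)) : Prop :=
  ∀ p : ℕ × ℕ, toR p ∈ hullOf L ↔ p ∈ L

/-- `b(Δ)`: the number of lattice points on the boundary of the polytope. -/
noncomputable def boundaryLatticeCount (L : Finset (ℕ × ℕ)) : ℕ :=
  Set.ncard {p : ℕ × ℕ | toR p ∈ frontier (hullOf L)}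

lemma geom_sum_inv_mul_sub {K : Type*} [Field K] {Y : K} (hY : Y ≠ 0) (b : K) (n : ℕ) :
    (∑ j ∈ Finset.range n, b ^ j * (Y ^ j)⁻¹) * (Y - b) = Y - Y * (b ^ n * (Y ^ n)⁻¹) := by
  induction n with
  | zero => simp
  | succ n ih =>
    rw [Finset.sum_range_succ, add_mul, ih]
    field_simp
    ring

section Kernel

variable {K : Type*} [Field K] [Algebra ℂ K]

/-- The value at `(X, Y)` of the part of `∑ c p x^p.1 y^p.2` of degree at most `i` in `x`. -/
noncomputable def lowerPart (L : Finset (ℕ × ℕ)) (c : ℕ × ℕ → ℂ) (X Y : K) (i : ℕ) : K :=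
  ∑ p ∈ L with p.1 ≤ i, algebraMap ℂ K (c p) * (X ^ p.1 * Y ^ p.2)

/-- `X / (X - a)` times the difference of the values of `∑ c p x^p.1 y^p.2` at `(X, Y)` and at
`(a, Y)`, expanded as a polynomial. -/
noncomputable def xQuot {A : Type*} [CommRing A] [Algebra ℂ A]
    (L : Finset (ℕ × ℕ)) (c : ℕ × ℕ → ℂ) (a : ℂ) (X Y : A) : A :=
  ∑ p ∈ L, algebraMap ℂ A (c p) * (Y ^ p.2 * ∑ i ∈ Finset.range p.1,
    algebraMap ℂ A a ^ i * X ^ (p.1 - i))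

/-- `Y / (Y - b)` times the difference of the values of `∑ c p x^p.1 y^p.2` at `(a, Y)` and at
`(a, b)`, expanded as a polynomial. -/
noncomputable def yQuot {A : Type*} [CommRing A] [Algebra ℂ A]
    (L : Finset (ℕ × ℕ)) (c : ℕ × ℕ → ℂ) (a b : ℂ) (Y : A) : A :=
  ∑ p ∈ L, algebraMap ℂ A (c p) * (algebraMap ℂ A a ^ p.1 * ∑ j ∈ Finset.range p.2,
    algebraMap ℂ A b ^ j * Y ^ (p.2 - j))

/-- The Laurent polynomial correcting the Bezout kernel at the ends of the curve. -/
noncomputable def kernelCorrection (L : Finset (ℕ × ℕ)) (c : ℕ × ℕ → ℂ) (a b : ℂ) (X Y : K)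
    (D : ℕ) (β : ℕ → ℕ) : K :=
  ∑ i ∈ Finset.range D, ∑ j ∈ Finset.range (β i),
    algebraMap ℂ K (a ^ i * b ^ j) * ((X ^ i)⁻¹ * (Y ^ j)⁻¹ * lowerPart L c X Y i)

variable {L : Finset (ℕ × ℕ)} {c : ℕ × ℕ → ℂ} {X Y : K}

lemma lowerPart_eq_neg_of_eq_zero
    (hP : ∑ p ∈ L, algebraMap ℂ K (c p) * (X ^ p.1 * Y ^ p.2) = 0) (i : ℕ) :
    lowerPart L c X Y i = -∑ p ∈ L with i < p.1, algebraMap ℂ K (c p) * (X ^ p.1 * Y ^ p.2) := by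
  rw [lowerPart, eq_neg_iff_add_eq_zero, ← hP,
    ← Finset.sum_filter_add_sum_filter_not L (fun p => p.1 ≤ i)]
  simp only [not_le]

lemma xQuot_eq_neg_sum_lowerPart (hX : X ≠ 0) (a : ℂ) {D : ℕ} (hD : ∀ p ∈ L, p.1 < D)
    (hP : ∑ p ∈ L, algebraMap ℂ K (c p) * (X ^ p.1 * Y ^ p.2) = 0) :
    xQuot L c a X Y =
      -∑ i ∈ Finset.range D, algebraMap ℂ K (a ^ i) * ((X ^ i)⁻¹ * lowerPart L c X Y i) := by
  simp only [lowerPart_eq_neg_of_eq_zero hP, mul_neg, Finset.sum_neg_distrib, neg_neg,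
    Finset.sum_filter, Finset.mul_sum, xQuot]
  rw [Finset.sum_comm]
  refine Finset.sum_congr rfl fun p hp => ?_
  rw [← Finset.sum_subset (Finset.range_mono (hD p hp).le)
    (fun i _ hi => by simp [not_lt.2 (by simpa using hi)])]
  refine Finset.sum_congr rfl fun i hi => ?_
  have hi : i < p.1 := by simpa using hi
  rw [if_pos hi, map_pow, pow_sub₀ _ hX hi.le]
  ring

/-- Closed form of the corrected kernel. -/
lemma corrected_kernel_mul (hX : X ≠ 0) (hY : Y ≠ 0) (a b : ℂ) {D : ℕ}
    (hD : ∀ p ∈ L, p.1 < D) (hP : ∑ p ∈ L, algebraMap ℂ K (c p) * (X ^ p.1 * Y ^ p.2) = 0)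
    {θ : K} (hθ : θ * (Y - algebraMap ℂ K b) = -(Y * xQuot L c a X Y)) (β : ℕ → ℕ) :
    (kernelCorrection L c a b X Y D β - θ) * (Y - algebraMap ℂ K b) =
      -(Y * ∑ i ∈ Finset.range D, algebraMap ℂ K (a ^ i * b ^ β i) *
        ((X ^ i)⁻¹ * (Y ^ β i)⁻¹ * lowerPart L c X Y i)) := by
  rw [sub_mul, hθ, xQuot_eq_neg_sum_lowerPart hX a hD hP, kernelCorrection, Finset.sum_mul,
    mul_neg, neg_neg, Finset.mul_sum, Finset.mul_sum, ← Finset.sum_sub_distrib,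
    ← Finset.sum_neg_distrib]
  refine Finset.sum_congr rfl fun i _ => ?_
  have h := geom_sum_inv_mul_sub hY (algebraMap ℂ K b) (β i)
  have h2 : ∑ j ∈ Finset.range (β i), algebraMap ℂ K (a ^ i * b ^ j) *
      ((X ^ i)⁻¹ * (Y ^ j)⁻¹ * lowerPart L c X Y i) =
      algebraMap ℂ K (a ^ i) * ((X ^ i)⁻¹ * lowerPart L c X Y i) *
        ∑ j ∈ Finset.range (β i), algebraMap ℂ K b ^ j * (Y ^ j)⁻¹ := by
    rw [Finset.mul_sum]
    refine Finset.sum_congr rfl fun j _ => ?_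
    rw [map_mul, map_pow _ b]
    ring
  rw [h2, mul_assoc _ _ (Y - algebraMap ℂ K b), h, map_mul, map_pow _ b]
  ring

end Kernel

section Valuation

variable {K Γ₀ : Type*} [Field K] [Algebra ℂ K] [LinearOrderedCommGroupWithZero Γ₀]
  {v : Valuation K Γ₀} {L : Finset (ℕ × ℕ)} {c : ℕ × ℕ → ℂ} {X Y : K}

lemma valuation_const_eq_one (hv : ∀ z : ℂ, v (algebraMap ℂ K z) ≤ 1) {z : ℂ} (hz : z ≠ 0) :
    v (algebraMap ℂ K z) = 1 := by
  refine le_antisymm (hv z) ?_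
  have h := hv z⁻¹
  rw [map_inv₀, map_inv₀] at h
  refine (inv_le_one₀ (zero_lt_iff.2 ?_)).1 h
  simpa using hz

lemma valuation_const_mul_le (hv : ∀ z : ℂ, v (algebraMap ℂ K z) ≤ 1) (z : ℂ) (x : K) :
    v (algebraMap ℂ K z * x) ≤ v x := by
  rw [map_mul]
  exact mul_le_of_le_one_left' (hv z)

/-- If no two monomials on either side of the column `i` dominate `X ^ i * Y ^ m` at once, then
the part of degree at most `i` of a polynomial vanishing at `(X, Y)` is small. -/
lemma valuation_lowerPart_lt (hv : ∀ z : ℂ, v (algebraMap ℂ K z) ≤ 1) (hX : X ≠ 0) (hY : Y ≠ 0)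
    (hP : ∑ p ∈ L, algebraMap ℂ K (c p) * (X ^ p.1 * Y ^ p.2) = 0) (i : ℕ) (m : ℤ)
    (h : ∀ p ∈ L, ∀ q ∈ L, p.1 ≤ i → i < q.1 →
      v Y ^ (((q.1 : ℤ) - i) * (p.2 - m) + ((i : ℤ) - p.1) * (q.2 - m)) < 1) :
    v (lowerPart L c X Y i) < v X ^ i * v Y ^ m := by
  have hx : v X ≠ 0 := by simpa using hX
  have hy : v Y ≠ 0 := by simpa using hY
  have hM : 0 < v X ^ i * v Y ^ m :=
    zero_lt_iff.2 (mul_ne_zero (pow_ne_zero _ hx) (zpow_ne_zero _ hy))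
  have key : (∀ p ∈ L, p.1 ≤ i → v X ^ p.1 * v Y ^ p.2 < v X ^ i * v Y ^ m) ∨
      (∀ q ∈ L, i < q.1 → v X ^ q.1 * v Y ^ q.2 < v X ^ i * v Y ^ m) := by
    by_contra! hcon
    obtain ⟨⟨p, hp, hpi, hpM⟩, ⟨q, hq, hqi, hqM⟩⟩ := hcon
    refine (h p hp q hq hpi hqi).not_ge ?_
    have aux : ∀ r : ℕ × ℕ, v X ^ i * v Y ^ m ≤ v X ^ r.1 * v Y ^ r.2 →
        1 ≤ v X ^ ((r.1 : ℤ) - i) * v Y ^ ((r.2 : ℤ) - m) := by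
      intro r hr
      rw [zpow_sub₀ hx, zpow_sub₀ hy, div_mul_div_comm, one_le_div₀ (by simpa using hM)]
      simpa using hr
    have h1 := one_le_pow_of_one_le' (aux p hpM) (q.1 - i)
    have h2 := one_le_pow_of_one_le' (aux q hqM) (i - p.1)
    have h3 := one_le_mul h1 h2
    refine h3.trans_eq ?_
    rw [← zpow_natCast, ← zpow_natCast, mul_zpow, mul_zpow, ← zpow_mul, ← zpow_mul, ← zpow_mul,
      ← zpow_mul, mul_mul_mul_comm, ← zpow_add₀ hx, ← zpow_add₀ hy, Nat.cast_sub hqi.le,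
      Nat.cast_sub hpi]
    have : ((p.1 : ℤ) - i) * (q.1 - i) + (q.1 - i) * (i - p.1) = 0 := by ring
    rw [this, zpow_zero, one_mul]
    ring_nf
  rcases key with key | key
  · refine Valuation.map_sum_lt' _ hM fun p hp => ?_
    rw [Finset.mem_filter] at hp
    refine (valuation_const_mul_le hv _ _).trans_lt ?_
    simpa using key p hp.1 hp.2
  · rw [lowerPart_eq_neg_of_eq_zero hP, Valuation.map_neg]
    refine Valuation.map_sum_lt' _ hM fun p hp => ?_
    rw [Finset.mem_filter] at hp
    refine (valuation_const_mul_le hv _ _).trans_lt ?_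
    simpa using key p hp.1 hp.2

lemma valuation_corrected_kernel_lt_one (hv : ∀ z : ℂ, v (algebraMap ℂ K z) ≤ 1)
    (hX : X ≠ 0) (hY : Y ≠ 0) (a b : ℂ) {D : ℕ}
    (hD : ∀ p ∈ L, p.1 < D) (hP : ∑ p ∈ L, algebraMap ℂ K (c p) * (X ^ p.1 * Y ^ p.2) = 0)
    {θ : K} (hθ : θ * (Y - algebraMap ℂ K b) = -(Y * xQuot L c a X Y)) (β : ℕ → ℕ)
    (hb : v (Y - algebraMap ℂ K b) ≠ 0)
    (h : ∀ i, v Y * v (lowerPart L c X Y i) <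
      v (Y - algebraMap ℂ K b) * (v X ^ i * v Y ^ β i)) :
    v (kernelCorrection L c a b X Y D β - θ) < 1 := by
  have hx : v X ≠ 0 := by simpa using hX
  have hy : v Y ≠ 0 := by simpa using hY
  have hb' : 0 < v (Y - algebraMap ℂ K b) := zero_lt_iff.2 hb
  have h1 := congrArg v (corrected_kernel_mul hX hY a b hD hP hθ β)
  rw [map_mul, Valuation.map_neg, Finset.mul_sum] at h1
  rw [← mul_lt_mul_iff_left₀ hb', one_mul, h1]
  refine Valuation.map_sum_lt' _ hb' fun i _ => ?_
  rw [mul_left_comm]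
  refine (valuation_const_mul_le hv _ _).trans_lt ?_
  have hxy : 0 < v X ^ i * v Y ^ β i :=
    zero_lt_iff.2 (mul_ne_zero (pow_ne_zero _ hx) (pow_ne_zero _ hy))
  rw [← mul_lt_mul_iff_left₀ hxy]
  refine lt_of_eq_of_lt ?_ (h i)
  simp only [map_mul, map_inv₀, map_pow]
  field_simp

/-- A family of complex weights and points of the torus such that the weighted sum of the values
of each monomial in `L` vanishes. -/
def IsMonomialRelation {ι : Type*} [Fintype ι] (L : Finset (ℕ × ℕ)) (w a b : ι → ℂ) : Prop :=
  ∀ m ∈ L, ∑ h, w h * (a h ^ m.1 * b h ^ m.2) = 0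

lemma IsMonomialRelation.map {ι : Type*} [Fintype ι] {w a b : ι → ℂ}
    (hw : IsMonomialRelation L w a b) {i j : ℕ} (hm : (i, j) ∈ L) :
    ∑ h, algebraMap ℂ K (w h) * algebraMap ℂ K (a h ^ i * b h ^ j) = 0 := by
  simp only [← map_mul, ← map_sum]
  rw [hw _ hm, map_zero]

lemma sum_kernelCorrection_eq {ι : Type*} [Fintype ι] {w a b : ι → ℂ}
    (hw : IsMonomialRelation L w a b) {β γ : ℕ → ℕ} (hβγ : ∀ i, β i ≤ γ i)
    (hL : ∀ i j, β i ≤ j → j < γ i → (i, j) ∈ L) (D : ℕ) (θ : ι → K) :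
    ∑ h, algebraMap ℂ K (w h) * (kernelCorrection L c (a h) (b h) X Y D β - θ h) =
      ∑ h, algebraMap ℂ K (w h) * (kernelCorrection L c (a h) (b h) X Y D γ - θ h) := by
  rw [← sub_eq_zero, ← neg_eq_zero, neg_sub, ← Finset.sum_sub_distrib]
  have h1 : ∀ h, kernelCorrection L c (a h) (b h) X Y D γ =
      kernelCorrection L c (a h) (b h) X Y D β +
      ∑ i ∈ Finset.range D, ∑ j ∈ Finset.Ico (β i) (γ i), algebraMap ℂ K (a h ^ i * b h ^ j) *
        ((X ^ i)⁻¹ * (Y ^ j)⁻¹ * lowerPart L c X Y i) := by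
    intro h
    rw [kernelCorrection, kernelCorrection, ← Finset.sum_add_distrib]
    exact Finset.sum_congr rfl fun i _ => (Finset.sum_range_add_sum_Ico _ (hβγ i)).symm
  simp only [h1, mul_sub, mul_add, add_sub_cancel_left, sub_sub_sub_cancel_right, Finset.mul_sum]
  rw [Finset.sum_comm]
  refine Finset.sum_eq_zero fun i _ => ?_
  rw [Finset.sum_comm]
  refine Finset.sum_eq_zero fun j hj => ?_
  rw [Finset.mem_Ico] at hj
  simp only [← mul_assoc, ← Finset.sum_mul]
  rw [hw.map (hL i j hj.1 hj.2)]
  simp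

end Valuation

section Quot

variable {A B : Type*} [CommRing A] [Algebra ℂ A] [CommRing B] [Algebra ℂ B]
  (L : Finset (ℕ × ℕ)) (c : ℕ × ℕ → ℂ)

lemma map_xQuot (f : A →ₐ[ℂ] B) (a : ℂ) (X Y : A) :
    f (xQuot L c a X Y) = xQuot L c a (f X) (f Y) := by
  simp [xQuot, map_sum]

lemma map_yQuot (f : A →ₐ[ℂ] B) (a b : ℂ) (Y : A) :
    f (yQuot L c a b Y) = yQuot L c a b (f Y) := by
  simp [yQuot, map_sum]

end Quot

/-- `β i ≤ j < γ i` describes the lattice points of `L` in the column `i`, and these bounds are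
compatible with the convex hull of `L`. -/
structure IsColumnBounds (L : Finset (ℕ × ℕ)) (β γ : ℕ → ℕ) : Prop where
  le : ∀ i, β i ≤ γ i
  mem : ∀ i j, β i ≤ j → j < γ i → (i, j) ∈ L
  le_snd : ∀ p ∈ L, β p.1 ≤ p.2
  snd_lt : ∀ p ∈ L, p.2 < γ p.1
  lower : ∀ i, ∀ p ∈ L, ∀ q ∈ L, p.1 ≤ i → i < q.1 →
    0 < ((q.1 : ℤ) - i) * (p.2 - (β i - 1)) + ((i : ℤ) - p.1) * (q.2 - (β i - 1))
  upper : ∀ i, ∀ p ∈ L, ∀ q ∈ L, p.1 ≤ i → i < q.1 →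
    ((q.1 : ℤ) - i) * (p.2 - γ i) + ((i : ℤ) - p.1) * (q.2 - γ i) < 0

lemma valuation_pow_sub_pow_le {K Γ₀ : Type*} [Field K] [LinearOrderedCommGroupWithZero Γ₀]
    {v : Valuation K Γ₀} {x y : K} (hx : v x ≤ 1) (hy : v y ≤ 1) (n : ℕ) :
    v (x ^ n - y ^ n) ≤ v (x - y) := by
  rw [← Commute.mul_geom_sum₂ (Commute.all x y), map_mul]
  refine mul_le_of_le_one_right' (Valuation.map_sum_le _ fun i _ => ?_)
  rw [map_mul, map_pow, map_pow]
  exact mul_le_one' (pow_le_one' hx _) (pow_le_one' hy _)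

section Ends

variable {K Γ₀ : Type*} [Field K] [Algebra ℂ K] [LinearOrderedCommGroupWithZero Γ₀]
  {v : Valuation K Γ₀} {L : Finset (ℕ × ℕ)} {c : ℕ × ℕ → ℂ} {X Y : K}

lemma valuation_sum_const_mul_le {ι : Type*} [Fintype ι] (hv : ∀ z : ℂ, v (algebraMap ℂ K z) ≤ 1)
    (w : ι → ℂ) (x : ι → K) {g : Γ₀} (hx : ∀ h, v (x h) ≤ g) :
    v (∑ h, algebraMap ℂ K (w h) * x h) ≤ g :=
  Valuation.map_sum_le _ fun h _ => (valuation_const_mul_le hv _ _).trans (hx h)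

lemma valuation_sum_const_mul_lt_one {ι : Type*} [Fintype ι]
    (hv : ∀ z : ℂ, v (algebraMap ℂ K z) ≤ 1)
    (w : ι → ℂ) (x : ι → K) (hx : ∀ h, v (x h) < 1) :
    v (∑ h, algebraMap ℂ K (w h) * x h) < 1 :=
  Valuation.map_sum_lt' _ zero_lt_one fun h _ => (valuation_const_mul_le hv _ _).trans_lt (hx h)

lemma valuation_corrected_kernel_lt_one_of_lt_one (hv : ∀ z : ℂ, v (algebraMap ℂ K z) ≤ 1)
    (hX : X ≠ 0) (hY : Y ≠ 0) {a b : ℂ} (hb : b ≠ 0) {D : ℕ} (hD : ∀ p ∈ L, p.1 < D)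
    (hP : ∑ p ∈ L, algebraMap ℂ K (c p) * (X ^ p.1 * Y ^ p.2) = 0)
    {θ : K} (hθ : θ * (Y - algebraMap ℂ K b) = -(Y * xQuot L c a X Y)) {β γ : ℕ → ℕ}
    (hβγ : IsColumnBounds L β γ) (hvY : v Y < 1) :
    v (kernelCorrection L c a b X Y D β - θ) < 1 := by
  have hy : 0 < v Y := zero_lt_iff.2 (by simpa using hY)
  have h1 : v (Y - algebraMap ℂ K b) = 1 := by
    rw [Valuation.map_sub_eq_of_lt_right] <;> rw [valuation_const_eq_one hv hb]
    exact hvY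
  refine valuation_corrected_kernel_lt_one hv hX hY a b hD hP hθ β (by simp [h1]) fun i => ?_
  have h2 := valuation_lowerPart_lt hv hX hY hP i ((β i : ℤ) - 1)
    fun p hp q hq hpi hqi => zpow_lt_one₀ hy hvY (hβγ.lower i p hp q hq hpi hqi)
  rw [zpow_sub_one₀ hy.ne', zpow_natCast, ← mul_assoc, lt_mul_inv_iff₀ hy] at h2
  rwa [h1, one_mul, mul_comm]

lemma valuation_corrected_kernel_lt_one_of_one_lt (hv : ∀ z : ℂ, v (algebraMap ℂ K z) ≤ 1)
    (hX : X ≠ 0) (hY : Y ≠ 0) {a b : ℂ} {D : ℕ} (hD : ∀ p ∈ L, p.1 < D)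
    (hP : ∑ p ∈ L, algebraMap ℂ K (c p) * (X ^ p.1 * Y ^ p.2) = 0)
    {θ : K} (hθ : θ * (Y - algebraMap ℂ K b) = -(Y * xQuot L c a X Y)) {β γ : ℕ → ℕ}
    (hβγ : IsColumnBounds L β γ) (hvY : 1 < v Y) :
    v (kernelCorrection L c a b X Y D γ - θ) < 1 := by
  have hy : 0 < v Y := zero_lt_iff.2 (by simpa using hY)
  have h1 : v (Y - algebraMap ℂ K b) = v Y :=
    Valuation.map_sub_eq_of_lt_left _ ((hv b).trans_lt hvY)
  refine valuation_corrected_kernel_lt_one hv hX hY a b hD hP hθ γ (by simpa [h1]) fun i => ?_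
  have h2 := valuation_lowerPart_lt hv hX hY hP i (γ i)
    fun p hp q hq hpi hqi => zpow_lt_one_of_neg₀ hvY (hβγ.upper i p hp q hq hpi hqi)
  rw [zpow_natCast] at h2
  rw [h1]
  exact mul_lt_mul_of_pos_left h2 hy

lemma valuation_yQuot_le (hv : ∀ z : ℂ, v (algebraMap ℂ K z) ≤ 1) (a b : ℂ) (hvY : v Y ≤ 1) :
    v (yQuot L c a b Y) ≤ 1 := by
  refine Valuation.map_sum_le _ fun p _ => (valuation_const_mul_le hv _ _).trans ?_
  rw [← map_pow]
  refine (valuation_const_mul_le hv _ _).trans (Valuation.map_sum_le _ fun j _ => ?_)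
  rw [← map_pow]
  refine (valuation_const_mul_le hv _ _).trans ?_
  rw [map_pow]
  exact pow_le_one' hvY _

lemma valuation_kernelCorrection_lt_one (hv : ∀ z : ℂ, v (algebraMap ℂ K z) ≤ 1) (hX : X ≠ 0)
    (hP : ∑ p ∈ L, algebraMap ℂ K (c p) * (X ^ p.1 * Y ^ p.2) = 0)
    (a b : ℂ) (D : ℕ) (β : ℕ → ℕ) (hvX : v X < 1) (hvY : v Y = 1) :
    v (kernelCorrection L c a b X Y D β) < 1 := by
  have hx : 0 < v X := zero_lt_iff.2 (by simpa using hX)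
  refine Valuation.map_sum_lt' _ zero_lt_one fun i _ =>
    Valuation.map_sum_lt' _ zero_lt_one fun j _ => (valuation_const_mul_le hv _ _).trans_lt ?_
  rw [map_mul, map_mul, map_inv₀, map_inv₀, map_pow, map_pow, hvY, one_pow, inv_one, mul_one,
    lowerPart_eq_neg_of_eq_zero hP, Valuation.map_neg, inv_mul_lt_iff₀ (pow_pos hx i), mul_one]
  refine Valuation.map_sum_lt' _ (pow_pos hx i) fun p hp =>
    (valuation_const_mul_le hv _ _).trans_lt ?_
  rw [Finset.mem_filter] at hp
  rw [map_mul, map_pow, map_pow, hvY, one_pow, mul_one]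
  exact pow_lt_pow_right_of_lt_one₀ hx hvX hp.2

lemma valuation_kernelCorrection_le_one (hv : ∀ z : ℂ, v (algebraMap ℂ K z) ≤ 1)
    (a b : ℂ) (D : ℕ) (β : ℕ → ℕ) (hvX : v X = 1) (hvY : v Y = 1) :
    v (kernelCorrection L c a b X Y D β) ≤ 1 := by
  refine Valuation.map_sum_le _ fun i _ =>
    Valuation.map_sum_le _ fun j _ => (valuation_const_mul_le hv _ _).trans ?_
  rw [map_mul, map_mul, map_inv₀, map_inv₀, map_pow, map_pow, hvY, hvX, one_pow, one_pow, inv_one,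
    mul_one, one_mul]
  refine Valuation.map_sum_le _ fun p hp => (valuation_const_mul_le hv _ _).trans ?_
  simp [hvX, hvY]

/-- Near an end with `X` infinite and `Y` finite, the initial form of the part of degree at most
`i` consists of the monomials in the column `i`. -/
lemma valuation_lowerPart_sub_lt_one (hv : ∀ z : ℂ, v (algebraMap ℂ K z) ≤ 1)
    (hvX : 1 < v X) (hvY : v Y = 1) (i : ℕ) :
    v ((X ^ i)⁻¹ * lowerPart L c X Y i -
      ∑ p ∈ L with p.1 = i, algebraMap ℂ K (c p) * Y ^ p.2) < 1 := by
  have hx : 0 < v X := zero_lt_one.trans hvX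
  have hX : X ≠ 0 := by rintro rfl; simp at hx
  have h1 : (X ^ i)⁻¹ * lowerPart L c X Y i -
      ∑ p ∈ L with p.1 = i, algebraMap ℂ K (c p) * Y ^ p.2 =
      ∑ p ∈ L with p.1 < i, algebraMap ℂ K (c p) * ((X ^ i)⁻¹ * (X ^ p.1 * Y ^ p.2)) := by
    rw [lowerPart, Finset.mul_sum, Finset.sum_filter, Finset.sum_filter, Finset.sum_filter,
      ← Finset.sum_sub_distrib]
    refine Finset.sum_congr rfl fun p _ => ?_
    rcases lt_trichotomy p.1 i with h | h | h
    · simp [h, h.le, h.ne, mul_left_comm]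
    · simp only [h, le_refl, if_true, lt_irrefl, if_false]
      field_simp
      simp
    · simp [h.not_ge, h.ne', h.not_gt]
  rw [h1]
  refine Valuation.map_sum_lt' _ zero_lt_one fun p hp =>
    (valuation_const_mul_le hv _ _).trans_lt ?_
  rw [Finset.mem_filter] at hp
  rw [map_mul, map_inv₀, map_mul, map_pow, map_pow, map_pow, hvY, one_pow, mul_one,
    inv_mul_lt_iff₀ (pow_pos hx i), mul_one]
  exact pow_lt_pow_right₀ hvX hp.2

lemma valuation_corrected_kernel_add_lt_one (hv : ∀ z : ℂ, v (algebraMap ℂ K z) ≤ 1)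
    {a b : ℂ} {D : ℕ} (hD : ∀ p ∈ L, p.1 < D)
    {θ : K} (hθ : θ * (X - algebraMap ℂ K a) = X * yQuot L c a b Y) {β γ : ℕ → ℕ}
    (hβγ : IsColumnBounds L β γ) (hvX : 1 < v X) (hvY : v Y = 1) :
    v (kernelCorrection L c a b X Y D β - θ + ∑ p ∈ L, ∑ j ∈ Finset.Ico (β p.1) p.2,
      algebraMap ℂ K (a ^ p.1 * b ^ j) * (algebraMap ℂ K (c p) * Y ^ (p.2 - j))) < 1 := by
  have hY : Y ≠ 0 := by rintro rfl; simp at hvY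
  set S := ∑ i ∈ Finset.range D, ∑ j ∈ Finset.range (β i), algebraMap ℂ K (a ^ i * b ^ j) *
    ((Y ^ j)⁻¹ * ∑ p ∈ L with p.1 = i, algebraMap ℂ K (c p) * Y ^ p.2) with hS
  have hsplit : yQuot L c a b Y = S + ∑ p ∈ L, ∑ j ∈ Finset.Ico (β p.1) p.2,
      algebraMap ℂ K (a ^ p.1 * b ^ j) * (algebraMap ℂ K (c p) * Y ^ (p.2 - j)) := by
    have hS' : S = ∑ p ∈ L, ∑ j ∈ Finset.range (β p.1),
        algebraMap ℂ K (a ^ p.1 * b ^ j) * (algebraMap ℂ K (c p) * Y ^ (p.2 - j)) := by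
      rw [← Finset.sum_fiberwise_of_maps_to (t := Finset.range D) (g := Prod.fst)
        (fun p hp => Finset.mem_range.2 (hD p hp)), hS]
      refine Finset.sum_congr rfl fun i _ => ?_
      simp only [Finset.mul_sum]
      rw [Finset.sum_comm]
      refine Finset.sum_congr rfl fun p hp => ?_
      rw [Finset.mem_filter] at hp
      rw [hp.2]
      refine Finset.sum_congr rfl fun j hj => ?_
      have hj : j ≤ p.2 := (Finset.mem_range.1 hj).le.trans (hp.2 ▸ hβγ.le_snd p hp.1)
      rw [pow_sub₀ _ hY hj]
      ring
    rw [hS', ← Finset.sum_add_distrib, yQuot]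
    refine Finset.sum_congr rfl fun p hp => ?_
    rw [Finset.sum_range_add_sum_Ico _ (hβγ.le_snd p hp)]
    simp only [Finset.mul_sum]
    refine Finset.sum_congr rfl fun j _ => ?_
    rw [map_mul, map_pow, map_pow]
    ring
  have hXa : v (X - algebraMap ℂ K a) = v X :=
    Valuation.map_sub_eq_of_lt_left _ ((hv a).trans_lt hvX)
  have h1 : v (yQuot L c a b Y - θ) < 1 := by
    have h2 : (yQuot L c a b Y - θ) * (X - algebraMap ℂ K a) =
        -(algebraMap ℂ K a * yQuot L c a b Y) := by
      rw [sub_mul, hθ]; ring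
    have h3 := congrArg v h2
    rw [map_mul, Valuation.map_neg, hXa] at h3
    have hx : 0 < v X := zero_lt_one.trans hvX
    rw [← mul_lt_mul_iff_left₀ hx, h3, one_mul]
    exact ((valuation_const_mul_le hv _ _).trans (valuation_yQuot_le hv a b hvY.le)).trans_lt hvX
  have h2 : v (kernelCorrection L c a b X Y D β - S) < 1 := by
    rw [kernelCorrection, hS, ← Finset.sum_sub_distrib]
    refine Valuation.map_sum_lt' _ zero_lt_one fun i _ => ?_
    rw [← Finset.sum_sub_distrib]
    refine Valuation.map_sum_lt' _ zero_lt_one fun j _ => ?_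
    rw [← mul_sub]
    refine (valuation_const_mul_le hv _ _).trans_lt ?_
    rw [mul_comm (X ^ i)⁻¹, mul_assoc, ← mul_sub, map_mul, map_inv₀, map_pow, hvY, one_pow,
      inv_one, one_mul]
    exact valuation_lowerPart_sub_lt_one hv hvX hvY i
  have h3 := Valuation.map_add_lt v h1 h2
  convert h3 using 2
  rw [hsplit]
  ring

lemma valuation_yQuot_le_sub (hv : ∀ z : ℂ, v (algebraMap ℂ K z) ≤ 1) {a b : ℂ} (hvY : v Y ≤ 1)
    (h0 : yQuot L c a b b = 0) : v (yQuot L c a b Y) ≤ v (Y - algebraMap ℂ K b) := by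
  have h1 : yQuot L c a b (algebraMap ℂ K b) = 0 := by
    have := map_yQuot L c (Algebra.ofId ℂ K) a b b
    rw [h0, map_zero] at this
    exact this.symm
  rw [← sub_zero (yQuot L c a b Y), ← h1, yQuot, yQuot, ← Finset.sum_sub_distrib]
  refine Valuation.map_sum_le _ fun p _ => ?_
  rw [← mul_sub, ← mul_sub, ← Finset.sum_sub_distrib, ← map_pow]
  refine (valuation_const_mul_le hv _ _).trans ((valuation_const_mul_le hv _ _).trans ?_)
  refine Valuation.map_sum_le _ fun j _ => ?_
  rw [← mul_sub, ← map_pow]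
  exact (valuation_const_mul_le hv _ _).trans (valuation_pow_sub_pow_le hvY (hv b) _)

lemma valuation_xQuot_le_sub (hv : ∀ z : ℂ, v (algebraMap ℂ K z) ≤ 1) {a b : ℂ}
    (hvX : v X ≤ 1) (hvY : v Y ≤ 1) (h0 : xQuot L c a a b = 0) :
    v (xQuot L c a X Y) ≤ max (v (X - algebraMap ℂ K a)) (v (Y - algebraMap ℂ K b)) := by
  have h1 : xQuot L c a (algebraMap ℂ K a) (algebraMap ℂ K b) = 0 := by
    have := map_xQuot L c (Algebra.ofId ℂ K) a a b
    rw [h0, map_zero] at this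
    exact this.symm
  rw [← sub_zero (xQuot L c a X Y), ← h1, xQuot, xQuot, ← Finset.sum_sub_distrib]
  refine Valuation.map_sum_le _ fun p _ => ?_
  rw [← mul_sub, Finset.mul_sum, Finset.mul_sum, ← Finset.sum_sub_distrib]
  refine (valuation_const_mul_le hv _ _).trans (Valuation.map_sum_le _ fun i _ => ?_)
  rw [mul_left_comm, mul_left_comm _ (algebraMap ℂ K a ^ i), ← mul_sub, ← map_pow]
  refine (valuation_const_mul_le hv _ _).trans ?_
  have h2 : Y ^ p.2 * X ^ (p.1 - i) - algebraMap ℂ K b ^ p.2 * algebraMap ℂ K a ^ (p.1 - i) =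
      Y ^ p.2 * (X ^ (p.1 - i) - algebraMap ℂ K a ^ (p.1 - i)) +
        algebraMap ℂ K (a ^ (p.1 - i)) * (Y ^ p.2 - algebraMap ℂ K b ^ p.2) := by
    rw [map_pow]; ring
  rw [h2]
  refine Valuation.map_add_le _ (le_max_of_le_left ?_) (le_max_of_le_right ?_)
  · rw [map_mul, map_pow]
    exact (mul_le_of_le_one_left' (pow_le_one' hvY _)).trans
      (valuation_pow_sub_pow_le hvX (hv a) _)
  · exact (valuation_const_mul_le hv _ _).trans (valuation_pow_sub_pow_le hvY (hv b) _)

/-- The Bezout kernel at a singular point is integral over the curve. -/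
lemma valuation_kernel_le_one (hv : ∀ z : ℂ, v (algebraMap ℂ K z) ≤ 1) {a b : ℂ} {θ : K}
    (hθy : θ * (Y - algebraMap ℂ K b) = -(Y * xQuot L c a X Y))
    (hθx : θ * (X - algebraMap ℂ K a) = X * yQuot L c a b Y)
    (hne : X ≠ algebraMap ℂ K a ∨ Y ≠ algebraMap ℂ K b)
    (hx0 : xQuot L c a a b = 0) (hy0 : yQuot L c a b b = 0)
    (hvX : v X = 1) (hvY : v Y = 1) : v θ ≤ 1 := by
  have h1 := congrArg v hθy
  have h2 := congrArg v hθx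
  rw [map_mul, Valuation.map_neg, map_mul, hvY, one_mul] at h1
  rw [map_mul, map_mul, hvX, one_mul] at h2
  have h3 := valuation_xQuot_le_sub hv hvX.le hvY.le hx0
  have h4 := valuation_yQuot_le_sub hv (L := L) (c := c) (a := a) hvY.le hy0
  rcases le_or_gt (v (X - algebraMap ℂ K a)) (v (Y - algebraMap ℂ K b)) with h | h
  · have hpos : 0 < v (Y - algebraMap ℂ K b) := by
      rw [zero_lt_iff]
      intro h0
      rw [h0, le_zero_iff, Valuation.zero_iff, sub_eq_zero] at h
      rw [Valuation.zero_iff, sub_eq_zero] at h0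
      exact hne.elim (fun h' => h' h) (fun h' => h' h0)
    rw [max_eq_right h, ← h1] at h3
    exact (mul_le_iff_le_one_left hpos).1 h3
  · have hpos : 0 < v (X - algebraMap ℂ K a) := zero_le.trans_lt h
    rw [← h2] at h4
    exact (mul_le_iff_le_one_left hpos).1 (h4.trans h.le)

end Ends

section Residue

variable {K : Type*} [Field K] [Algebra ℂ K] {L : Finset (ℕ × ℕ)} {c : ℕ × ℕ → ℂ} {X Y : K}
  {ι : Type*} [Fintype ι] {w a b : ι → ℂ} {θ : ι → K}

/-- `θ` is the Bezout kernel at the point `(a, b)`: it satisfies the two relations expressing it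
as a quotient, at least one of which has a nonzero denominator. -/
structure IsKernelAt (L : Finset (ℕ × ℕ)) (c : ℕ × ℕ → ℂ) (X Y : K) (a b : ℂ) (θ : K) :
    Prop where
  mul_y : θ * (Y - algebraMap ℂ K b) = -(Y * xQuot L c a X Y)
  mul_x : θ * (X - algebraMap ℂ K a) = X * yQuot L c a b Y
  ne : X ≠ algebraMap ℂ K a ∨ Y ≠ algebraMap ℂ K b

lemma IsMonomialRelation.sum_quot_eq_zero (hw : IsMonomialRelation L w a b) {β γ : ℕ → ℕ}
    (hβγ : IsColumnBounds L β γ) :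
    ∑ h, algebraMap ℂ K (w h) * ∑ p ∈ L, ∑ j ∈ Finset.Ico (β p.1) p.2,
      algebraMap ℂ K (a h ^ p.1 * b h ^ j) * (algebraMap ℂ K (c p) * Y ^ (p.2 - j)) = 0 := by
  simp only [Finset.mul_sum]
  rw [Finset.sum_comm]
  refine Finset.sum_eq_zero fun p hp => ?_
  rw [Finset.sum_comm]
  refine Finset.sum_eq_zero fun j hj => ?_
  rw [Finset.mem_Ico] at hj
  simp only [← mul_assoc, ← Finset.sum_mul]
  rw [hw.map (hβγ.mem _ j hj.1 (hj.2.trans (hβγ.snd_lt p hp)))]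
  simp

section Valuation

variable {Γ₀ : Type*} [LinearOrderedCommGroupWithZero Γ₀] {v : Valuation K Γ₀}

/-- The weighted sum of the kernels is small at the points where `X` or `Y` is not a unit. -/
lemma valuation_sum_kernel_lt_one (hv : ∀ z : ℂ, v (algebraMap ℂ K z) ≤ 1)
    (hX : X ≠ 0) (hY : Y ≠ 0) (hP : ∑ p ∈ L, algebraMap ℂ K (c p) * (X ^ p.1 * Y ^ p.2) = 0)
    (hw : IsMonomialRelation L w a b) (ha : ∀ h, a h ≠ 0) (hb : ∀ h, b h ≠ 0)
    (hθ : ∀ h, IsKernelAt L c X Y (a h) (b h) (θ h)) {β γ : ℕ → ℕ} (hβγ : IsColumnBounds L β γ)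
    {D : ℕ} (hD : ∀ p ∈ L, p.1 < D) (hXY : v X ≠ 1 ∨ v Y ≠ 1) :
    v (∑ h, algebraMap ℂ K (w h) * (kernelCorrection L c (a h) (b h) X Y D β - θ h)) < 1 := by
  rcases lt_trichotomy (v Y) 1 with hvY | hvY | hvY
  · exact valuation_sum_const_mul_lt_one hv _ _ fun h =>
      valuation_corrected_kernel_lt_one_of_lt_one hv hX hY (hb h) hD hP (hθ h).mul_y hβγ hvY
  · rcases lt_or_gt_of_ne (hXY.resolve_right (not_not.2 hvY)) with hvX | hvX
    · refine valuation_sum_const_mul_lt_one hv _ _ fun h => Valuation.map_sub_lt v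
        (valuation_kernelCorrection_lt_one hv hX hP _ _ D β hvX hvY) ?_
      have h1 : v (X - algebraMap ℂ K (a h)) = 1 := by
        rw [Valuation.map_sub_eq_of_lt_right] <;> rw [valuation_const_eq_one hv (ha h)]
        exact hvX
      have h2 := congrArg v (hθ h).mul_x
      rw [map_mul, h1, mul_one, map_mul] at h2
      rw [h2]
      exact mul_lt_one_of_lt_of_le hvX (valuation_yQuot_le hv _ _ hvY.le)
    · have h1 := valuation_sum_const_mul_lt_one hv w _ fun h =>
        valuation_corrected_kernel_add_lt_one hv hD (hθ h).mul_x hβγ hvX hvY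
      simp only [mul_add, Finset.sum_add_distrib] at h1
      rwa [hw.sum_quot_eq_zero hβγ, add_zero] at h1
  · rw [sum_kernelCorrection_eq hw hβγ.le hβγ.mem]
    exact valuation_sum_const_mul_lt_one hv _ _ fun h =>
      valuation_corrected_kernel_lt_one_of_one_lt hv hX hY hD hP (hθ h).mul_y hβγ hvY

lemma valuation_sum_kernel_le_one (hv : ∀ z : ℂ, v (algebraMap ℂ K z) ≤ 1)
    (hX : X ≠ 0) (hY : Y ≠ 0) (hP : ∑ p ∈ L, algebraMap ℂ K (c p) * (X ^ p.1 * Y ^ p.2) = 0)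
    (hw : IsMonomialRelation L w a b) (ha : ∀ h, a h ≠ 0) (hb : ∀ h, b h ≠ 0)
    (hx0 : ∀ h, xQuot L c (a h) (a h) (b h) = 0) (hy0 : ∀ h, yQuot L c (a h) (b h) (b h) = 0)
    (hθ : ∀ h, IsKernelAt L c X Y (a h) (b h) (θ h)) {β γ : ℕ → ℕ} (hβγ : IsColumnBounds L β γ)
    {D : ℕ} (hD : ∀ p ∈ L, p.1 < D) :
    v (∑ h, algebraMap ℂ K (w h) * (kernelCorrection L c (a h) (b h) X Y D β - θ h)) ≤ 1 := by
  by_cases hXY : v X ≠ 1 ∨ v Y ≠ 1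
  · exact (valuation_sum_kernel_lt_one hv hX hY hP hw ha hb hθ hβγ hD hXY).le
  · push Not at hXY
    refine valuation_sum_const_mul_le hv _ _ fun h => Valuation.map_sub_le v
      (valuation_kernelCorrection_le_one hv _ _ D β hXY.1 hXY.2) ?_
    exact valuation_kernel_le_one hv (hθ h).mul_y (hθ h).mul_x (hθ h).ne (hx0 h) (hy0 h)
      hXY.1 hXY.2

end Valuation

/-- An element of a field extension of `ℂ` which is integral at all valuations trivial on `ℂ` is
constant. -/
lemma mem_range_algebraMap_of_valuation_le_one {f : K}
    (hf : ∀ V : ValuationSubring K, (∀ z : ℂ, V.valuation (algebraMap ℂ K z) ≤ 1) →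
      V.valuation f ≤ 1) : ∃ z : ℂ, algebraMap ℂ K z = f := by
  by_contra hcon
  have : IsIntegrallyClosedIn (algebraMap ℂ K).range K := by
    rw [isIntegrallyClosedIn_iff]
    refine ⟨Subtype.val_injective, fun {x} hx => ?_⟩
    have hx' : IsIntegral ℂ x := by
      obtain ⟨p, hp, hpx⟩ := hx
      have hsurj : Function.Surjective (algebraMap ℂ K).rangeRestrict :=
        (algebraMap ℂ K).rangeRestrict_surjective
      obtain ⟨q, hq, -, hqm⟩ := Polynomial.lifts_and_degree_eq_and_monic
        ((Polynomial.mem_lifts p).2 (Polynomial.map_surjective _ hsurj p)) hp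
      refine ⟨q, hqm, ?_⟩
      rw [← hq, Polynomial.eval₂_map] at hpx
      exact hpx
    obtain ⟨z, rfl⟩ := minpoly.mem_range_of_degree_eq_one ℂ x
      (IsAlgClosed.degree_eq_one_of_irreducible ℂ (minpoly.irreducible hx'))
    exact ⟨⟨_, z, rfl⟩, rfl⟩
  obtain ⟨V, hV, hfV⟩ := Subring.exists_le_valuationSubring_of_isIntegrallyClosedIn
    (R := (algebraMap ℂ K).range) (x := f) (fun ⟨z, hz⟩ => hcon ⟨z, hz⟩)
  exact hfV ((V.valuation_le_one_iff f).1 (hf V fun z =>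
    (V.valuation_le_one_iff _).2 (hV ⟨z, rfl⟩)))

/-- The weighted sum of the corrected kernels vanishes on each curve. -/
theorem sum_kernel_eq_zero
    (hX : X ≠ 0) (hY : Y ≠ 0) (hP : ∑ p ∈ L, algebraMap ℂ K (c p) * (X ^ p.1 * Y ^ p.2) = 0)
    (hw : IsMonomialRelation L w a b) (ha : ∀ h, a h ≠ 0) (hb : ∀ h, b h ≠ 0)
    (hx0 : ∀ h, xQuot L c (a h) (a h) (b h) = 0) (hy0 : ∀ h, yQuot L c (a h) (b h) (b h) = 0)
    (hθ : ∀ h, IsKernelAt L c X Y (a h) (b h) (θ h)) {β γ : ℕ → ℕ} (hβγ : IsColumnBounds L β γ)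
    {D : ℕ} (hD : ∀ p ∈ L, p.1 < D)
    (hconst : ¬((∃ z, algebraMap ℂ K z = X) ∧ ∃ z, algebraMap ℂ K z = Y)) :
    ∑ h, algebraMap ℂ K (w h) * (kernelCorrection L c (a h) (b h) X Y D β - θ h) = 0 := by
  obtain ⟨z, hz⟩ := mem_range_algebraMap_of_valuation_le_one fun V hV =>
    valuation_sum_kernel_le_one hV hX hY hP hw ha hb hx0 hy0 hθ hβγ hD
  rw [← hz]
  by_contra hne
  have hz0 : z ≠ 0 := by rintro rfl; simp at hne
  have key : ∀ V : ValuationSubring K, (∀ z : ℂ, V.valuation (algebraMap ℂ K z) ≤ 1) →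
      V.valuation X = 1 ∧ V.valuation Y = 1 := by
    intro V hV
    by_contra hcon
    have h1 := valuation_sum_kernel_lt_one hV hX hY hP hw ha hb hθ hβγ hD
      (not_and_or.1 hcon)
    rw [← hz, valuation_const_eq_one hV hz0] at h1
    exact lt_irrefl _ h1
  exact hconst ⟨mem_range_algebraMap_of_valuation_le_one fun V hV => (key V hV).1.le,
    mem_range_algebraMap_of_valuation_le_one fun V hV => (key V hV).2.le⟩

end Residue

section Columns

lemma snd_nonneg_of_mem_hullOf {L : Finset (ℕ × ℕ)} {x : ℝ × ℝ} (hx : x ∈ hullOf L) :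
    0 ≤ x.2 := by
  have h : hullOf L ⊆ {x : ℝ × ℝ | 0 ≤ x.2} := by
    refine convexHull_min ?_ (convex_halfSpace_ge (IsLinearMap.mk (by simp) (by simp)) 0)
    rintro _ ⟨p, -, rfl⟩
    exact Nat.cast_nonneg (α := ℝ) p.2
  exact h hx

lemma isCompact_hullOf (L : Finset (ℕ × ℕ)) : IsCompact (hullOf L) :=
  ((L.finite_toSet.image toR).isCompact_convexHull ℝ)

lemma IsLatticePolytopeSet.exists_column {L : Finset (ℕ × ℕ)} (hL : IsLatticePolytopeSet L)
    (i : ℕ) : ∃ β γ : ℕ, β ≤ γ ∧ (∀ j, β ≤ j → j < γ → (i, j) ∈ L) ∧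
      ∀ h : ℝ, ((i : ℝ), h) ∈ hullOf L → (β : ℝ) - 1 < h ∧ h < γ := by
  set C : Set ℝ := {h | ((i : ℝ), h) ∈ hullOf L} with hC
  have hCc : IsCompact C := by
    have : C = Prod.snd '' (hullOf L ∩ Prod.fst ⁻¹' {(i : ℝ)}) := by
      ext h
      constructor
      · exact fun hh => ⟨(i, h), ⟨hh, rfl⟩, rfl⟩
      · rintro ⟨⟨x, y⟩, ⟨hxy, rfl⟩, rfl⟩
        exact hxy
    rw [this]
    exact ((isCompact_hullOf L).inter_right (isClosed_singleton.preimage continuous_fst)).image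
      continuous_snd
  have hCconv : Convex ℝ C := by
    intro x hx y hy s t hs ht hst
    have := convex_convexHull ℝ _ hx hy hs ht hst
    have h2 : s • ((i : ℝ), x) + t • ((i : ℝ), y) = ((i : ℝ), s • x + t • y) := by
      ext <;> simp [← add_mul, hst]
    rwa [h2] at this
  rcases C.eq_empty_or_nonempty with he | hne
  · exact ⟨0, 0, le_rfl, by simp, fun h hh => by simpa [he] using (show h ∈ C from hh)⟩
  obtain ⟨m, hm, hmin⟩ := hCc.exists_isLeast hne
  obtain ⟨M, hM, hmax⟩ := hCc.exists_isGreatest hne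
  have hm0 : 0 ≤ m := snd_nonneg_of_mem_hullOf hm
  have hmM : m ≤ M := hmin hM
  refine ⟨⌈m⌉₊, ⌊M⌋₊ + 1, (Nat.ceil_mono hmM).trans (Nat.ceil_le_floor_add_one M), ?_, ?_⟩
  · intro j h1 h2
    refine (hL (i, j)).1 (hCconv.ordConnected.out hm hM ⟨Nat.ceil_le.1 h1, ?_⟩)
    exact (Nat.le_floor_iff (hm0.trans hmM)).1 (Nat.lt_succ_iff.1 h2)
  · intro h hh
    refine ⟨?_, ?_⟩
    · linarith [Nat.ceil_lt_add_one hm0, hmin hh]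
    · push_cast
      exact (hmax hh).trans_lt (Nat.lt_floor_add_one M)

lemma mem_hullOf_of_mem {L : Finset (ℕ × ℕ)} {p : ℕ × ℕ} (hp : p ∈ L) :
    ((p.1 : ℝ), (p.2 : ℝ)) ∈ hullOf L :=
  subset_convexHull ℝ _ ⟨p, hp, rfl⟩

lemma crossing_mem_hullOf {L : Finset (ℕ × ℕ)} {p q : ℕ × ℕ} (hp : p ∈ L) (hq : q ∈ L) {i : ℕ}
    (hpi : p.1 ≤ i) (hiq : i < q.1) :
    ((i : ℝ), (((q.1 : ℝ) - i) * p.2 + ((i : ℝ) - p.1) * q.2) / ((q.1 : ℝ) - p.1)) ∈ hullOf L := by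
  have h1 : (p.1 : ℝ) ≤ i := by exact_mod_cast hpi
  have h2 : (i : ℝ) < q.1 := by exact_mod_cast hiq
  have h3 : 0 < (q.1 : ℝ) - p.1 := by linarith
  have h4 := convex_convexHull ℝ (toR '' (L : Set (ℕ × ℕ))) (mem_hullOf_of_mem hp)
    (mem_hullOf_of_mem hq) (a := ((q.1 : ℝ) - i) / ((q.1 : ℝ) - p.1))
    (b := ((i : ℝ) - p.1) / ((q.1 : ℝ) - p.1)) (div_nonneg (by linarith) h3.le)
    (div_nonneg (by linarith) h3.le) (by field_simp; ring)
  simp only [Prod.smul_mk, Prod.mk_add_mk, smul_eq_mul] at h4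
  refine (congrArg (· ∈ hullOf L) (Prod.ext ?_ ?_)).mpr h4
  · field_simp
    ring
  · field_simp

lemma IsLatticePolytopeSet.exists_isColumnBounds {L : Finset (ℕ × ℕ)}
    (hL : IsLatticePolytopeSet L) : ∃ β γ : ℕ → ℕ, IsColumnBounds L β γ := by
  choose β γ hle hmem hC using hL.exists_column
  refine ⟨β, γ, hle, hmem, fun p hp => ?_, fun p hp => ?_, ?_, ?_⟩
  · have := (hC _ _ (mem_hullOf_of_mem hp)).1
    rw [sub_lt_iff_lt_add] at this
    exact Nat.lt_succ_iff.1 (by exact_mod_cast this)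
  · exact_mod_cast (hC _ _ (mem_hullOf_of_mem hp)).2
  · intro i p hp q hq hpi hiq
    have h := (hC _ _ (crossing_mem_hullOf hp hq hpi hiq)).1
    have h3 : 0 < (q.1 : ℝ) - p.1 := sub_pos.2 (by exact_mod_cast hpi.trans_lt hiq)
    rw [lt_div_iff₀ h3] at h
    have : (0 : ℝ) < ((q.1 : ℝ) - i) * (p.2 - (β i - 1)) + ((i : ℝ) - p.1) * (q.2 - (β i - 1)) := by
      linarith
    exact_mod_cast this
  · intro i p hp q hq hpi hiq
    have h := (hC _ _ (crossing_mem_hullOf hp hq hpi hiq)).2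
    have h3 : 0 < (q.1 : ℝ) - p.1 := sub_pos.2 (by exact_mod_cast hpi.trans_lt hiq)
    rw [div_lt_iff₀ h3] at h
    have : ((q.1 : ℝ) - i) * (p.2 - γ i) + ((i : ℝ) - p.1) * (q.2 - γ i) < (0 : ℝ) := by
      linarith
    exact_mod_cast this

end Columns

section PlaneCurve

variable {s : Fin 2 → ℂ}

lemma exists_irreducible_dvd_of_eval_eq_zero {P : MvPolynomial (Fin 2) ℂ} (hP : P ≠ 0)
    (hs : eval s P = 0) : ∃ F, Irreducible F ∧ F ∣ P ∧ eval s F = 0 := by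
  induction P using WfDvdMonoid.induction_on_irreducible with
  | zero => exact absurd rfl hP
  | unit u hu => exact absurd hs (hu.map (eval s)).ne_zero
  | mul P F hP0 hF ih =>
    rw [map_mul, mul_eq_zero] at hs
    rcases hs with hs | hs
    · exact ⟨F, hF, dvd_mul_right _ _, hs⟩
    · obtain ⟨F', h1, h2, h3⟩ := ih hP0 hs
      exact ⟨F', h1, h2.mul_left _, h3⟩

/-- A polynomial vanishing on every branch at a node is singular there. -/
lemma IsNodeAt.eval_pderiv_eq_zero {P G : MvPolynomial (Fin 2) ℂ} (hP : IsNodeAt P s)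
    (hG : ∀ F, Irreducible F → F ∣ P → eval s F = 0 → F ∣ G) (i : Fin 2) :
    eval s (pderiv i G) = 0 := by
  obtain ⟨⟨-, -, hPs, hP0, hP1⟩, hHess⟩ := hP
  have hPne : P ≠ 0 := by rintro rfl; simp at hHess
  have hPi : eval s (pderiv i P) = 0 :=
    Fin.forall_fin_two (p := fun i => eval s (pderiv i P) = 0) |>.2 ⟨hP0, hP1⟩ i
  obtain ⟨F, hF, ⟨H, rfl⟩, hFs⟩ := exists_irreducible_dvd_of_eval_eq_zero hPne hPs
  obtain ⟨M, rfl⟩ := hG F hF (dvd_mul_right _ _) hFs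
  simp only [Derivation.leibniz, smul_eq_mul, map_add, map_mul, hFs, zero_mul, zero_add]
    at hPi ⊢
  by_cases hHs : eval s H = 0
  · obtain ⟨F₂, hF₂, hF₂H, hF₂s⟩ :=
      exists_irreducible_dvd_of_eval_eq_zero (right_ne_zero_of_mul hPne) hHs
    rcases hF₂.prime.dvd_or_dvd (hG F₂ hF₂ (hF₂H.mul_left _) hF₂s) with h | ⟨M', rfl⟩
    · obtain ⟨H', rfl⟩ := (hF₂.dvd_symm hF h).trans hF₂H
      refine absurd ?_ hHess
      simp only [Derivation.leibniz, smul_eq_mul, map_add, map_mul, hFs]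
      ring
    · simp [hF₂s]
  · rw [(mul_eq_zero.1 hPi).resolve_left hHs, mul_zero]

/-- The function field of an irreducible plane curve. -/
lemma exists_functionField {F : MvPolynomial (Fin 2) ℂ} (hF : Irreducible F) :
    ∃ (K : Type) (_ : Field K) (_ : Algebra ℂ K) (π : MvPolynomial (Fin 2) ℂ →ₐ[ℂ] K),
      ∀ g, π g = 0 ↔ F ∣ g := by
  have : (Ideal.span {F}).IsPrime := (Ideal.span_singleton_prime hF.ne_zero).2 hF.prime
  refine ⟨FractionRing (MvPolynomial (Fin 2) ℂ ⧸ Ideal.span {F}), inferInstance, inferInstance,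
    (IsScalarTower.toAlgHom ℂ (MvPolynomial (Fin 2) ℂ ⧸ Ideal.span {F}) _).comp
      (Ideal.Quotient.mkₐ ℂ _), fun g => ?_⟩
  simp [Ideal.Quotient.eq_zero_iff_mem, Ideal.mem_span_singleton]

/-- The coordinate functions are not both constant on an irreducible plane curve. -/
lemma not_dvd_sub_C_and_dvd_sub_C {F : MvPolynomial (Fin 2) ℂ} (hFs : eval s F = 0) (a b : ℂ) :
    ¬(F ∣ X 0 - C a ∧ F ∣ X 1 - C b) := by
  rintro ⟨⟨u, hu⟩, ⟨u', hu'⟩⟩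
  have h0 := congrArg (fun G => eval s (pderiv 0 G)) hu
  have h1 := congrArg (fun G => eval s (pderiv 1 G)) hu
  have h2 := congrArg (fun G => eval s (pderiv 1 G)) hu'
  simp [Derivation.leibniz, pderiv_X, hFs] at h0 h1 h2
  rcases h1 with h1 | h1
  · simp [h1] at h0
  · simp [h1] at h2

/-- The elements of `R` which are fractions of values of polynomials whose denominator does not
vanish at `s`. -/
def regularAt {R : Type*} [CommRing R] [Algebra ℂ R] (π : MvPolynomial (Fin 2) ℂ →ₐ[ℂ] R)
    (s : Fin 2 → ℂ) : Subalgebra ℂ R where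
  carrier := {x | ∃ u g, eval s u ≠ 0 ∧ π u * x = π g}
  mul_mem' := by
    rintro x y ⟨u, g, hu, hx⟩ ⟨u', g', hu', hy⟩
    refine ⟨u * u', g * g', by simp [hu, hu'], ?_⟩
    rw [map_mul, map_mul, ← hx, ← hy]
    ring
  add_mem' := by
    rintro x y ⟨u, g, hu, hx⟩ ⟨u', g', hu', hy⟩
    refine ⟨u * u', u' * g + u * g', by simp [hu, hu'], ?_⟩
    rw [map_mul, map_add, map_mul, map_mul, ← hx, ← hy]
    ring
  algebraMap_mem' z := ⟨1, C z, by simp, by simp [← MvPolynomial.algebraMap_eq]⟩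

lemma map_mem_regularAt {R : Type*} [CommRing R] [Algebra ℂ R]
    (π : MvPolynomial (Fin 2) ℂ →ₐ[ℂ] R) (g : MvPolynomial (Fin 2) ℂ) : π g ∈ regularAt π s :=
  ⟨1, g, by simp, by simp⟩

end PlaneCurve

section QuotIdentities

lemma sub_mul_sum_pow {A : Type*} [CommRing A] (x y : A) (n : ℕ) :
    (x - y) * ∑ i ∈ Finset.range n, y ^ i * x ^ (n - i) = x * (x ^ n - y ^ n) := by
  rw [← neg_sub (y ^ n), ← Commute.mul_geom_sum₂ (Commute.all y x), Finset.mul_sum,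
    Finset.mul_sum, ← Finset.sum_neg_distrib, Finset.mul_sum]
  refine Finset.sum_congr rfl fun i hi => ?_
  have : n - i = n - 1 - i + 1 := by have := Finset.mem_range.1 hi; omega
  rw [this, pow_succ]
  ring

variable {A : Type*} [CommRing A] [Algebra ℂ A] (L : Finset (ℕ × ℕ)) (c : ℕ × ℕ → ℂ)

/-- The value of `∑ c p x^p.1 y^p.2` at `(X, Y)`. -/
noncomputable def polyVal (X Y : A) : A :=
  ∑ p ∈ L, algebraMap ℂ A (c p) * (X ^ p.1 * Y ^ p.2)

lemma sub_mul_xQuot (a : ℂ) (X Y : A) :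
    (X - algebraMap ℂ A a) * xQuot L c a X Y =
      X * (polyVal L c X Y - polyVal L c (algebraMap ℂ A a) Y) := by
  simp only [xQuot, polyVal, ← Finset.sum_sub_distrib]
  rw [Finset.mul_sum, Finset.mul_sum]
  refine Finset.sum_congr rfl fun p _ => ?_
  rw [mul_left_comm, mul_left_comm (X - _), sub_mul_sum_pow]
  ring

lemma sub_mul_yQuot (a b : ℂ) (Y : A) :
    (Y - algebraMap ℂ A b) * yQuot L c a b Y =
      Y * (polyVal L c (algebraMap ℂ A a) Y -
        polyVal L c (algebraMap ℂ A a) (algebraMap ℂ A b)) := by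
  simp only [yQuot, polyVal, ← Finset.sum_sub_distrib]
  rw [Finset.mul_sum, Finset.mul_sum]
  refine Finset.sum_congr rfl fun p _ => ?_
  rw [mul_left_comm, mul_left_comm (Y - _), sub_mul_sum_pow]
  ring

lemma map_polyVal {B : Type*} [CommRing B] [Algebra ℂ B] (f : A →ₐ[ℂ] B) (X Y : A) :
    f (polyVal L c X Y) = polyVal L c (f X) (f Y) := by
  simp [polyVal, map_sum]

lemma exists_isKernelAt {K : Type*} [Field K] [Algebra ℂ K] {X Y : K} {a b : ℂ}
    (hP : polyVal L c X Y = 0) (hab : polyVal L c a b = 0)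
    (hne : X ≠ algebraMap ℂ K a ∨ Y ≠ algebraMap ℂ K b) :
    ∃ θ, IsKernelAt L c X Y a b θ := by
  have hab' : polyVal L c (algebraMap ℂ K a) (algebraMap ℂ K b) = 0 := by
    have := map_polyVal L c (Algebra.ofId ℂ K) a b
    rw [hab, map_zero] at this
    exact this.symm
  have h1 := sub_mul_xQuot L c a X Y
  have h2 := sub_mul_yQuot L c a b Y
  rw [hP, zero_sub] at h1
  rw [hab', sub_zero] at h2
  by_cases hX : X = algebraMap ℂ K a
  · have hY := sub_ne_zero.2 (hne.resolve_left (not_not.2 hX))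
    refine ⟨-(Y * xQuot L c a X Y) / (Y - algebraMap ℂ K b), div_mul_cancel₀ _ hY, ?_, hne⟩
    rw [div_mul_eq_mul_div, div_eq_iff hY]
    linear_combination -Y * h1 - X * h2
  · have hX := sub_ne_zero.2 hX
    refine ⟨X * yQuot L c a b Y / (X - algebraMap ℂ K a), ?_, div_mul_cancel₀ _ hX, hne⟩
    rw [div_mul_eq_mul_div, div_eq_iff hX]
    linear_combination X * h2 + Y * h1

end QuotIdentities

section Independence

variable {s : Fin 2 → ℂ} {L : Finset (ℕ × ℕ)} {c : ℕ × ℕ → ℂ}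

lemma pderiv_zero_polyVal_C (a : ℂ) :
    pderiv 0 (polyVal L c (C a) (X 1 : MvPolynomial (Fin 2) ℂ)) = 0 := by
  simp [polyVal, map_sum, Derivation.leibniz, Derivation.leibniz_pow, pderiv_X,
    MvPolynomial.algebraMap_eq]

lemma pderiv_zero_yQuot (a b : ℂ) :
    pderiv 0 (yQuot L c a b (X 1 : MvPolynomial (Fin 2) ℂ)) = 0 := by
  simp [yQuot, map_sum, Derivation.leibniz, Derivation.leibniz_pow, pderiv_X,
    MvPolynomial.algebraMap_eq]

/-- First and second order behaviour of the two difference quotients at a singular point. -/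
lemma IsSingAt.eval_quot {P R Q T : MvPolynomial (Fin 2) ℂ} (hP : IsSingAt P s)
    (hQ : (X 0 - C (s 0)) * Q = X 0 * (P - R)) (hT : (X 1 - C (s 1)) * T = X 1 * R)
    (hR : pderiv 0 R = 0) :
    (eval s Q = 0 ∧ eval s T = 0) ∧
      2 * eval s (pderiv 0 Q) = s 0 * eval s (pderiv 0 (pderiv 0 P)) ∧
      eval s (pderiv 1 Q) = s 0 * eval s (pderiv 1 (pderiv 0 P)) := by
  obtain ⟨h0, -, hPs, hP0, hP1⟩ := hP
  have e := congrArg (eval s) hQ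
  have e0 := congrArg (fun G => eval s (pderiv 0 G)) hQ
  have e1 := congrArg (fun G => eval s (pderiv 1 G)) hQ
  have e00 := congrArg (fun G => eval s (pderiv 0 (pderiv 0 G))) hQ
  have e10 := congrArg (fun G => eval s (pderiv 1 (pderiv 0 G))) hQ
  have f1 := congrArg (fun G => eval s (pderiv 1 G)) hT
  simp [Derivation.leibniz, pderiv_X, hR, hPs, hP0, hP1, h0] at e e0 e1 e00 e10 f1
  refine ⟨⟨?_, ?_⟩, ?_, ?_⟩
  · linear_combination e0 - e
  · linear_combination f1 + s 1 * e1 + e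
  · linear_combination e00
  · linear_combination e10 - e1

/-- The two difference quotients of a polynomial at a singular point. -/
lemma IsSingAt.eval_xQuot_yQuot (hP : IsSingAt (polyVal L c (X 0) (X 1)) s) :
    polyVal L c (s 0) (s 1) = 0 ∧ xQuot L c (s 0) (s 0) (s 1) = 0 ∧
      yQuot L c (s 0) (s 1) (s 1) = 0 ∧
      2 * eval s (pderiv 0 (xQuot L c (s 0) (X 0) (X 1))) =
        s 0 * eval s (pderiv 0 (pderiv 0 (polyVal L c (X 0) (X 1)))) ∧
      eval s (pderiv 1 (xQuot L c (s 0) (X 0) (X 1))) =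
        s 0 * eval s (pderiv 1 (pderiv 0 (polyVal L c (X 0) (X 1)))) := by
  have h0 : polyVal L c (s 0) (s 1) = 0 := by
    have h := hP.2.2.1
    rw [← coe_aeval_eq_eval, RingHom.coe_coe, map_polyVal] at h
    simpa using h
  have h0' : polyVal L c (C (s 0)) (C (s 1)) = (0 : MvPolynomial (Fin 2) ℂ) := by
    have h := map_polyVal L c (Algebra.ofId ℂ (MvPolynomial (Fin 2) ℂ)) (s 0) (s 1)
    rw [h0, map_zero] at h
    exact h.symm
  have h2 := sub_mul_yQuot L c (s 0) (s 1) (X 1 : MvPolynomial (Fin 2) ℂ)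
  rw [MvPolynomial.algebraMap_eq, h0', sub_zero] at h2
  obtain ⟨⟨h3, h4⟩, h5⟩ := hP.eval_quot (sub_mul_xQuot L c (s 0) (X 0) (X 1)) h2
    (pderiv_zero_polyVal_C (s 0))
  refine ⟨h0, ?_, ?_, h5⟩
  · rw [← coe_aeval_eq_eval, RingHom.coe_coe, map_xQuot] at h3
    simpa using h3
  · rw [← coe_aeval_eq_eval, RingHom.coe_coe, map_yQuot] at h4
    simpa using h4

section Regular

variable {J : Type*} {K : J → Type*} [∀ F, Field (K F)] [∀ F, Algebra ℂ (K F)]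
  (π : ∀ F, MvPolynomial (Fin 2) ℂ →ₐ[ℂ] K F)

lemma inv_mem_regularAt {u : MvPolynomial (Fin 2) ℂ} (hu : eval s u ≠ 0) (h : ∀ F, π F u ≠ 0) :
    (fun F => (π F u)⁻¹) ∈ regularAt (AlgHom.pi π) s :=
  ⟨u, 1, hu, by ext F; simp [h F]⟩

lemma kernelCorrection_mem_regularAt (h0 : s 0 ≠ 0) (h1 : s 1 ≠ 0)
    (hX : ∀ F, π F (X 0) ≠ 0) (hY : ∀ F, π F (X 1) ≠ 0) (a b : ℂ) (D : ℕ) (β : ℕ → ℕ) :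
    (fun F => kernelCorrection L c a b (π F (X 0)) (π F (X 1)) D β) ∈
      regularAt (AlgHom.pi π) s := by
  have h : (fun F => kernelCorrection L c a b (π F (X 0)) (π F (X 1)) D β) =
      ∑ i ∈ Finset.range D, ∑ j ∈ Finset.range (β i), algebraMap ℂ (∀ F, K F) (a ^ i * b ^ j) *
        ((fun F => (π F (X 0 ^ i))⁻¹) * (fun F => (π F (X 1 ^ j))⁻¹) *
          AlgHom.pi π (∑ p ∈ L with p.1 ≤ i, C (c p) * (X 0 ^ p.1 * X 1 ^ p.2))) := by
    ext F
    simp [kernelCorrection, lowerPart, Finset.sum_apply, ← MvPolynomial.algebraMap_eq]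
  rw [h]
  refine Subalgebra.sum_mem _ fun i _ => Subalgebra.sum_mem _ fun j _ =>
    Subalgebra.mul_mem _ (Subalgebra.algebraMap_mem _ _) (Subalgebra.mul_mem _
      (Subalgebra.mul_mem _ (inv_mem_regularAt π ?_ fun F => ?_)
        (inv_mem_regularAt π ?_ fun F => ?_)) (map_mem_regularAt _ _))
  · simp [h0]
  · simp [hX F]
  · simp [h1]
  · simp [hY F]

lemma IsKernelAt.mem_regularAt {a b : ℂ} {θ : ∀ F, K F}
    (hθ : ∀ F, IsKernelAt L c (π F (X 0)) (π F (X 1)) a b (θ F)) (hab : s 0 ≠ a ∨ s 1 ≠ b) :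
    θ ∈ regularAt (AlgHom.pi π) s := by
  rcases hab with h | h
  · refine ⟨X 0 - C a, X 0 * yQuot L c a b (X 1), by simpa [sub_eq_zero] using h, ?_⟩
    ext F
    have := (hθ F).mul_x
    simp [map_yQuot, ← MvPolynomial.algebraMap_eq, ← this, mul_comm]
  · refine ⟨X 1 - C b, -(X 1 * xQuot L c a (X 0) (X 1)), by simpa [sub_eq_zero] using h, ?_⟩
    ext F
    have := (hθ F).mul_y
    simp [map_xQuot, ← MvPolynomial.algebraMap_eq, ← this, mul_comm]

end Regular

/-- The nodes of a plane curve impose independent conditions on the polynomials whose Newton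
polytope lies in that of the curve. -/
theorem IsMonomialRelation.eq_zero_of_isNodeAt {ι : Type*} [Fintype ι]
    (hL : IsLatticePolytopeSet L) {t : ι → Fin 2 → ℂ} (htinj : Function.Injective t)
    (hnodes : ∀ h, IsNodeAt (polyVal L c (X 0) (X 1)) (t h)) {w : ι → ℂ}
    (hw : IsMonomialRelation L w (fun h => t h 0) (fun h => t h 1)) (k : ι) : w k = 0 := by
  classical
  by_contra hk
  set P : MvPolynomial (Fin 2) ℂ := polyVal L c (X 0) (X 1) with hPdef
  have hsing := fun h => (hnodes h).1.eval_xQuot_yQuot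
  obtain ⟨β, γ, hβγ⟩ := hL.exists_isColumnBounds
  obtain ⟨D, hD⟩ : ∃ D, ∀ p ∈ L, p.1 < D :=
    ⟨L.sup Prod.fst + 1, fun p hp => Nat.lt_succ_of_le (Finset.le_sup (f := Prod.fst) hp)⟩
  choose K instF instA π hπ using
    fun F : {F // Irreducible F ∧ F ∣ P ∧ eval (t k) F = 0} => exists_functionField F.2.1
  have hPF : ∀ F, polyVal L c (π F (X 0)) (π F (X 1)) = 0 := fun F => by
    rw [← map_polyVal, hπ]
    exact F.2.2.1
  have hsub : ∀ F i (z : ℂ), π F (X i) = algebraMap ℂ (K F) z → F.1 ∣ X i - C z := by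
    intro F i z h
    rw [← hπ, map_sub, h, ← MvPolynomial.algebraMap_eq, AlgHom.commutes, sub_self]
  have hX : ∀ F i, π F (X i) ≠ 0 := by
    intro F i h
    obtain ⟨u, hu⟩ := (hπ F (X i)).1 h
    have h1 := congrArg (eval (t k)) hu
    rw [eval_X, map_mul, F.2.2.2, zero_mul] at h1
    exact (Fin.forall_fin_two (p := fun i => t k i ≠ 0)).2
      ⟨(hnodes k).1.1, (hnodes k).1.2.1⟩ i h1
  have hne : ∀ F (a b : ℂ),
      π F (X 0) ≠ algebraMap ℂ (K F) a ∨ π F (X 1) ≠ algebraMap ℂ (K F) b := by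
    intro F a b
    by_contra! h
    exact not_dvd_sub_C_and_dvd_sub_C F.2.2.2 a b ⟨hsub F 0 a h.1, hsub F 1 b h.2⟩
  choose θ hθ using fun h F => exists_isKernelAt L c (hPF F) (hsing h).1 (hne F _ _)
  have hsum : ∀ F, ∑ h, algebraMap ℂ (K F) (w h) *
      (kernelCorrection L c (t h 0) (t h 1) (π F (X 0)) (π F (X 1)) D β - θ h F) = 0 := by
    intro F
    refine sum_kernel_eq_zero (hX F 0) (hX F 1) (hPF F) hw (fun h => (hnodes h).1.1)
      (fun h => (hnodes h).1.2.1) (fun h => (hsing h).2.1) (fun h => (hsing h).2.2.1)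
      (fun h => hθ h F) hβγ hD ?_
    rintro ⟨⟨z, hz⟩, z', hz'⟩
    exact (hne F z z').elim (fun h => h hz.symm) (fun h => h hz'.symm)
  have hreg : θ k ∈ regularAt (AlgHom.pi π) (t k) := by
    have h1 : θ k = (w k)⁻¹ • (∑ h, w h • (fun F =>
        kernelCorrection L c (t h 0) (t h 1) (π F (X 0)) (π F (X 1)) D β) -
        ∑ h ∈ Finset.univ.erase k, w h • θ h) := by
      ext F
      have h2 := hsum F
      simp only [mul_sub, Finset.sum_sub_distrib] at h2
      rw [← Finset.add_sum_erase _ (fun h => algebraMap ℂ (K F) (w h) * θ h F)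
        (Finset.mem_univ k), ← sub_sub, sub_right_comm, sub_eq_zero] at h2
      simp only [Pi.smul_apply, Pi.sub_apply, Finset.sum_apply]
      simp only [Algebra.smul_def]
      rw [h2, map_inv₀, inv_mul_cancel_left₀ (by simpa using hk)]
    rw [h1]
    refine Subalgebra.smul_mem _ (Subalgebra.sub_mem _
      (Subalgebra.sum_mem _ fun h _ => Subalgebra.smul_mem _ ?_ _)
      (Subalgebra.sum_mem _ fun h hh => Subalgebra.smul_mem _ ?_ _)) _
    · exact kernelCorrection_mem_regularAt π (hnodes k).1.1 (hnodes k).1.2.1 (fun F => hX F 0)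
        (fun F => hX F 1) _ _ D β
    · refine IsKernelAt.mem_regularAt π (hθ h) ?_
      by_contra! hcon
      refine Finset.ne_of_mem_erase hh (htinj (funext ?_))
      exact Fin.forall_fin_two.2 ⟨hcon.1.symm, hcon.2.symm⟩
  obtain ⟨u, g, hu, hg⟩ := hreg
  have hg : ∀ F, π F u * θ k F = π F g := fun F => congrFun hg F
  have hG₁ := (hnodes k).eval_pderiv_eq_zero
    (G := u * (X 1 * xQuot L c (t k 0) (X 0) (X 1)) + g * (X 1 - C (t k 1)))
    fun F h1 h2 h3 => by
      rw [← hπ ⟨F, h1, h2, h3⟩]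
      simp only [map_add, map_mul, map_sub, map_xQuot, ← hg, ← MvPolynomial.algebraMap_eq,
        AlgHom.commutes]
      linear_combination π ⟨F, h1, h2, h3⟩ u * (hθ k ⟨F, h1, h2, h3⟩).mul_y
  have hG₂ := (hnodes k).eval_pderiv_eq_zero
    (G := u * (X 0 * yQuot L c (t k 0) (t k 1) (X 1)) - g * (X 0 - C (t k 0)))
    fun F h1 h2 h3 => by
      rw [← hπ ⟨F, h1, h2, h3⟩]
      simp only [map_mul, map_sub, map_yQuot, ← hg, ← MvPolynomial.algebraMap_eq,
        AlgHom.commutes]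
      linear_combination -π ⟨F, h1, h2, h3⟩ u * (hθ k ⟨F, h1, h2, h3⟩).mul_x
  have hxq : eval (t k) (xQuot L c (t k 0) (X 0) (X 1)) = 0 := by
    rw [← coe_aeval_eq_eval, RingHom.coe_coe, map_xQuot]
    simpa using (hsing k).2.1
  have hyq : eval (t k) (yQuot L c (t k 0) (t k 1) (X 1)) = 0 := by
    rw [← coe_aeval_eq_eval, RingHom.coe_coe, map_yQuot]
    simpa using (hsing k).2.2.1
  obtain ⟨-, -, -, h00, h10⟩ := hsing k
  obtain ⟨⟨hs0, hs1, -⟩, hHess⟩ := hnodes k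
  have e0 := hG₁ 0
  have e1 := hG₁ 1
  have f0 := hG₂ 0
  simp [Derivation.leibniz, pderiv_X, hxq, hyq, hu, hs1, pderiv_zero_yQuot]
    at e0 e1 f0
  rw [e0, mul_zero, eq_comm, mul_eq_zero, or_iff_right hs0] at h00
  rw [f0, add_zero, mul_eq_zero, or_iff_right hu, mul_eq_zero, or_iff_right hs1] at e1
  rw [e1, eq_comm, mul_eq_zero, or_iff_right hs0] at h10
  rw [hPdef, h00, h10, zero_mul, mul_zero, sub_zero] at hHess
  exact hHess rfl

end Independence

section Evaluation

variable {L : Finset (ℕ × ℕ)}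

lemma toPoly_eq_polyVal (Q : Coef L) :
    toPoly Q = polyVal L (fun p => if h : p ∈ L then Q ⟨p, h⟩ else 0) (X 0) (X 1) := by
  rw [toPoly, polyVal, ← Finset.sum_coe_sort L]
  refine Finset.sum_congr rfl fun p _ => ?_
  rw [dif_pos p.2, MvPolynomial.algebraMap_eq, monomial_eq, Finsupp.prod_add_index']
  · simp
  · simp
  · simp [pow_add]

/-- `toPoly` as a linear map. -/
noncomputable def toPolyₗ (L : Finset (ℕ × ℕ)) : Coef L →ₗ[ℂ] MvPolynomial (Fin 2) ℂ where
  toFun := toPoly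
  map_add' Q R := by simp [toPoly, Finset.sum_add_distrib]
  map_smul' z Q := by simp [toPoly, Finset.smul_sum, smul_monomial]

lemma toPolyₗ_apply (Q : Coef L) : toPolyₗ L Q = toPoly Q := rfl

lemma eval_toPoly_single (m : {p // p ∈ L}) (z : Fin 2 → ℂ) :
    eval z (toPoly (Pi.single m 1 : Coef L)) = z 0 ^ m.1.1 * z 1 ^ m.1.2 := by
  rw [toPoly, Finset.sum_eq_single m]
  · rw [monomial_eq, Finsupp.prod_add_index'] <;> simp [pow_add]
  · intro p _ hp
    simp [hp]
  · simp

/-- The values at the nodes of a curve can be prescribed independently. -/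
theorem surjective_eval_of_isNodeAt (hL : IsLatticePolytopeSet L) {N : ℕ} {P0 : Coef L}
    {t : Fin N → Fin 2 → ℂ} (htinj : Function.Injective t)
    (hnodes : ∀ h, IsNodeAt (toPoly P0) (t h)) (y : Fin N → ℂ) :
    ∃ Q : Coef L, ∀ h, eval (t h) (toPoly Q) = y h := by
  let ev : Coef L →ₗ[ℂ] (Fin N → ℂ) :=
    LinearMap.pi fun h => (aeval (t h)).toLinearMap ∘ₗ toPolyₗ L
  have hev : ∀ Q h, ev Q h = eval (t h) (toPoly Q) := fun Q h => by
    rw [← coe_aeval_eq_eval]; rfl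
  suffices h : LinearMap.range ev = ⊤ by
    obtain ⟨Q, hQ⟩ := LinearMap.range_eq_top.1 h y
    exact ⟨Q, fun h => by rw [← hev, hQ]⟩
  by_contra hne
  obtain ⟨f, hf, hker⟩ := Submodule.exists_le_ker_of_lt_top _ (lt_top_iff_ne_top.2 hne)
  refine hf (LinearMap.ext fun v => ?_)
  rw [LinearMap.pi_apply_eq_sum_univ f v]
  refine Finset.sum_eq_zero fun h _ => ?_
  simp only [toPoly_eq_polyVal] at hnodes
  have hw : IsMonomialRelation L (fun h => f fun j => if h = j then 1 else 0)
      (fun h => t h 0) (fun h => t h 1) := by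
    intro m hm
    have h0 : f (ev (Pi.single ⟨m, hm⟩ 1)) = 0 := hker ⟨_, rfl⟩
    rw [LinearMap.pi_apply_eq_sum_univ f] at h0
    simpa only [hev, eval_toPoly_single, smul_eq_mul, mul_comm] using h0
  rw [show f (fun j => if h = j then 1 else 0) = 0 from hw.eq_zero_of_isNodeAt hL htinj hnodes h,
    smul_zero]

end Evaluation

section Analytic

open scoped ContDiff Topology

lemma contDiff_eval (f : MvPolynomial (Fin 2) ℂ) :
    ContDiff ℂ ω (fun z : Fin 2 → ℂ => eval z f) := by
  induction f using MvPolynomial.induction_on with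
  | C a => simpa using contDiff_const
  | add p q hp hq => simpa using hp.add hq
  | mul_X p i hp => simpa using hp.mul (contDiff_apply ℂ ℂ i)

lemma hasFDerivAt_eval (f : MvPolynomial (Fin 2) ℂ) (z : Fin 2 → ℂ) :
    HasFDerivAt (fun z : Fin 2 → ℂ => eval z f)
      (∑ i, eval z (pderiv i f) • ContinuousLinearMap.proj (R := ℂ) (φ := fun _ => ℂ) i) z := by
  induction f using MvPolynomial.induction_on with
  | C a =>
    simp only [eval_C]
    refine (hasFDerivAt_const (𝕜 := ℂ) a z).congr_fderiv ?_
    ext v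
    simp
  | add p q hp hq =>
    simp only [map_add]
    refine (hp.fun_add hq).congr_fderiv ?_
    ext v
    simp [Fin.sum_univ_two]
    ring
  | mul_X p i hp =>
    simp only [map_mul, eval_X]
    refine (hp.fun_mul (hasFDerivAt_apply (𝕜 := ℂ) i z)).congr_fderiv ?_
    ext v
    fin_cases i <;> simp [Derivation.leibniz, pderiv_X, Fin.sum_univ_two] <;> ring

variable {L : Finset (ℕ × ℕ)} (T : Coef L →ₗ[ℂ] MvPolynomial (Fin 2) ℂ)

lemma contDiff_eval_linear :
    ContDiff ℂ ω (fun v : Coef L × (Fin 2 → ℂ) => eval v.2 (T v.1)) := by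
  have h : ∀ v : Coef L × (Fin 2 → ℂ),
      eval v.2 (T v.1) = ∑ p, v.1 p * eval v.2 (T (Pi.single p 1)) := by
    intro v
    rw [LinearMap.pi_apply_eq_sum_univ T v.1, map_sum]
    refine Finset.sum_congr rfl fun p _ => ?_
    rw [smul_eval]
    congr 3
    ext j
    simp [Pi.single_apply, eq_comm]
  simp only [h]
  exact ContDiff.sum fun p _ => ((contDiff_apply ℂ ℂ p).comp contDiff_fst).mul
    ((contDiff_eval _).comp contDiff_snd)

lemma hasFDerivAt_eval_linear_left (z : Fin 2 → ℂ) (Q : Coef L) :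
    HasFDerivAt (fun Q => eval z (T Q))
      (LinearMap.toContinuousLinearMap ((aeval (R := ℂ) z).toLinearMap ∘ₗ T)) Q :=
  (LinearMap.toContinuousLinearMap ((aeval (R := ℂ) z).toLinearMap ∘ₗ T)).hasFDerivAt

lemma fderiv_eval_linear_apply (Q R : Coef L) (z ζ : Fin 2 → ℂ) :
    fderiv ℂ (fun v : Coef L × (Fin 2 → ℂ) => eval v.2 (T v.1)) (Q, z) (R, ζ) =
      eval z (T R) + ∑ i, eval z (pderiv i (T Q)) * ζ i := by
  have h := ((contDiff_eval_linear T).differentiable (by simp) (Q, z)).hasFDerivAt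
  have h1 := HasFDerivAt.comp (f := fun Q => (Q, z)) Q h (hasFDerivAt_prodMk_left Q z)
    |>.unique (hasFDerivAt_eval_linear_left T z Q)
  have h2 := HasFDerivAt.comp (f := fun z => (Q, z)) z h (hasFDerivAt_prodMk_right Q z)
    |>.unique (hasFDerivAt_eval (T Q) z)
  have h1 := congrArg (fun A => A R) h1
  have h2 := congrArg (fun A => A ζ) h2
  have h3 : ((R, ζ) : Coef L × (Fin 2 → ℂ)) = (R, 0) + (0, ζ) := by simp
  rw [h3, map_add]
  simp at h1 h2
  rw [h1, h2]
  simp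

/-- The map whose zeros are the critical points of the polynomials. -/
noncomputable def gradEval (L : Finset (ℕ × ℕ)) (v : Coef L × (Fin 2 → ℂ)) : Fin 2 → ℂ :=
  fun i => eval v.2 (pderiv i (toPoly v.1))

lemma contDiff_gradEval : ContDiff ℂ ω (gradEval L) :=
  contDiff_pi.2 fun i => contDiff_eval_linear ((pderiv i).toLinearMap ∘ₗ toPolyₗ L)

lemma isInvertible_fderiv_gradEval {Q : Coef L} {z : Fin 2 → ℂ} (h : IsNodeAt (toPoly Q) z) :
    (fderiv ℂ (gradEval L) (Q, z) ∘L .inr ℂ (Coef L) (Fin 2 → ℂ)).IsInvertible := by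
  set A := fderiv ℂ (gradEval L) (Q, z) ∘L .inr ℂ (Coef L) (Fin 2 → ℂ) with hA
  have hAζ : ∀ ζ i, A ζ i = ∑ j, eval z (pderiv j (pderiv i (toPoly Q))) * ζ j := by
    intro ζ i
    have h1 := fderiv_eval_linear_apply ((pderiv i).toLinearMap ∘ₗ toPolyₗ L) Q 0 z ζ
    have h2 : A ζ i = fderiv ℂ (fun v => gradEval L v i) (Q, z) (0, ζ) := by
      rw [fderiv_apply (contDiff_gradEval.differentiable (by simp) _)]
      rfl
    rw [h2]
    refine h1.trans ?_
    simp [toPolyₗ_apply, show toPoly (0 : Coef L) = 0 from map_zero (toPolyₗ L)]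
  have hinj : Function.Injective (A : (Fin 2 → ℂ) →ₗ[ℂ] (Fin 2 → ℂ)) := by
    rw [injective_iff_map_eq_zero]
    intro ζ hζ
    have h0 := hAζ ζ 0
    have h1 := hAζ ζ 1
    have hζ : A ζ = 0 := hζ
    rw [hζ, Pi.zero_apply, Fin.sum_univ_two] at h0 h1
    have hd := h.2
    refine funext (Fin.forall_fin_two.2 ⟨?_, ?_⟩) <;> refine (mul_eq_zero.1 ?_).resolve_left hd
    · linear_combination eval z (pderiv 1 (pderiv 0 (toPoly Q))) * h1 -
        eval z (pderiv 1 (pderiv 1 (toPoly Q))) * h0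
    · linear_combination eval z (pderiv 0 (pderiv 1 (toPoly Q))) * h0 -
        eval z (pderiv 0 (pderiv 0 (toPoly Q))) * h1
  exact ⟨(LinearEquiv.ofInjectiveEndo _ hinj).toContinuousLinearEquiv, by ext; rfl⟩

end Analytic

section Transversality

open scoped ContDiff Topology
open Filter

variable {L : Finset (ℕ × ℕ)}

/-- Near a node, the critical points of nearby polynomials form the graph of an analytic map. -/
lemma exists_criticalPoint {P0 : Coef L} {s : Fin 2 → ℂ} (h : IsNodeAt (toPoly P0) s) :
    ∃ ψ : Coef L → Fin 2 → ℂ, AnalyticAt ℂ ψ P0 ∧ ψ P0 = s ∧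
      ∀ᶠ v in 𝓝 (P0, s), gradEval L v = 0 ↔ ψ v.1 = v.2 := by
  have hc : ContDiffAt ℂ ω (gradEval L) (P0, s) := contDiff_gradEval.contDiffAt
  have hi := isInvertible_fderiv_gradEval h
  have h0 : gradEval L (P0, s) = 0 :=
    funext (Fin.forall_fin_two.2 ⟨h.1.2.2.2.1, h.1.2.2.2.2⟩)
  refine ⟨hc.implicitFunction (by simp) hi,
    (ContDiffAt.contDiffAt_implicitFunction hc (by simp) hi).analyticAt,
    ContDiffAt.implicitFunction_apply_self hc (by simp) hi, ?_⟩
  simpa only [h0] using ContDiffAt.eventually_apply_eq_iff_implicitFunction hc (by simp) hi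

/-- Near a curve with a node, the curves with a singular point near the node are the zeros of an
analytic function, whose differential is the evaluation at the node. -/
lemma exists_local_equation {P0 : Coef L} {s : Fin 2 → ℂ} (h : IsNodeAt (toPoly P0) s) :
    ∃ φ : Coef L → ℂ, AnalyticAt ℂ φ P0 ∧ (∀ R, fderiv ℂ φ P0 R = eval s (toPoly R)) ∧
      ∀ᶠ δ in 𝓝[>] (0 : ℝ), ∀ᶠ Q in 𝓝 P0,
        (φ Q = 0 ↔ ∃ z, dist z s < δ ∧ IsSingAt (toPoly Q) z) := by
  obtain ⟨ψ, hψ, hψ0, hiff⟩ := exists_criticalPoint h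
  have hE := contDiff_eval_linear (toPolyₗ L)
  refine ⟨fun Q => eval (ψ Q) (toPoly Q),
    (hE.contDiffAt (x := (P0, ψ P0))).analyticAt.comp₂ analyticAt_id hψ, fun R => ?_, ?_⟩
  · have hd : HasFDerivAt (fun Q => (Q, ψ Q))
        ((ContinuousLinearMap.id ℂ (Coef L)).prod (fderiv ℂ ψ P0)) P0 :=
      (hasFDerivAt_id P0).prodMk hψ.differentiableAt.hasFDerivAt
    have hE' := (hE.differentiable (by simp) (P0, ψ P0)).hasFDerivAt
    have hφ := HasFDerivAt.comp (f := fun Q => (Q, ψ Q)) P0 hE' hd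
    refine (congrArg (fun A => A R) hφ.fderiv).trans ?_
    refine (fderiv_eval_linear_apply (toPolyₗ L) P0 R (ψ P0) (fderiv ℂ ψ P0 R)).trans ?_
    rw [hψ0, Fin.sum_univ_two, toPolyₗ_apply, toPolyₗ_apply, h.1.2.2.2.1, h.1.2.2.2.2]
    simp
  · rw [nhds_prod_eq, eventually_prod_iff] at hiff
    obtain ⟨p, hp, q, hq, hpq⟩ := hiff
    have htorus : ∀ᶠ z in 𝓝 s, z 0 ≠ 0 ∧ z 1 ≠ 0 :=
      ((continuous_apply 0).continuousAt.eventually_ne h.1.1).and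
        ((continuous_apply 1).continuousAt.eventually_ne h.1.2.1)
    obtain ⟨ε, hε, hball⟩ := Metric.eventually_nhds_iff.1 (hq.and htorus)
    filter_upwards [Ioo_mem_nhdsGT hε] with δ hδ
    have hclose : ∀ᶠ Q in 𝓝 P0, dist (ψ Q) s < δ := by
      have := hψ.continuousAt.eventually (Metric.ball_mem_nhds (ψ P0) hδ.1)
      rwa [hψ0] at this
    filter_upwards [hp, hclose] with Q hQ hQδ
    constructor
    · intro h0
      obtain ⟨hqQ, hz0, hz1⟩ := hball (hQδ.trans hδ.2)
      have hgrad := (hpq hQ hqQ).2 rfl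
      exact ⟨ψ Q, hQδ, hz0, hz1, h0, congrFun hgrad 0, congrFun hgrad 1⟩
    · rintro ⟨z, hz, -, -, h0, hg0, hg1⟩
      have hzψ : ψ Q = z := (hpq hQ (hball (hz.trans hδ.2)).1).1
        (funext (Fin.forall_fin_two.2 ⟨hg0, hg1⟩))
      simpa only [hzψ] using h0

/-- Surjectivity onto a finite-dimensional space is an open condition. -/
lemma ContinuousLinearMap.eventually_surjective {E F : Type*} [NormedAddCommGroup E]
    [NormedSpace ℂ E] [NormedAddCommGroup F] [NormedSpace ℂ F] [FiniteDimensional ℂ F]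
    {A : E →L[ℂ] F} (hA : Function.Surjective A) :
    ∀ᶠ A' : E →L[ℂ] F in 𝓝 A, Function.Surjective A' := by
  have : CompleteSpace F := FiniteDimensional.complete ℂ F
  obtain ⟨B, hB⟩ := (A : E →ₗ[ℂ] F).exists_rightInverse_of_surjective (LinearMap.range_eq_top.2 hA)
  have hc : Continuous fun A' : E →L[ℂ] F => A' ∘L LinearMap.toContinuousLinearMap B :=
    continuous_id.clm_comp continuous_const
  have h1 : A ∘L LinearMap.toContinuousLinearMap B = 1 :=
    ContinuousLinearMap.ext fun v => LinearMap.congr_fun hB v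
  have hunit : IsUnit (A ∘L LinearMap.toContinuousLinearMap B) := h1 ▸ isUnit_one
  filter_upwards [hc.continuousAt.eventually (Units.isOpen.mem_nhds hunit)] with A' hA'
  obtain ⟨u, hu⟩ := hA'
  intro v
  refine ⟨B ((↑u⁻¹ : F →L[ℂ] F) v), ?_⟩
  exact (congrArg (fun C : F →L[ℂ] F => C ((↑u⁻¹ : F →L[ℂ] F) v)) hu).symm.trans
    (congrArg (fun C : F →L[ℂ] F => C v) u.mul_inv)

end Transversality

/-- **Brusotti theorem.** If the curve `{P₀ = 0}`, `P₀ ∈ P(Δ)`, has exactly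
`N` nondegenerate double points `t₁, …, t_N` in `(ℂ*)²` and no other singular points, then
near `P₀` the loci `B'_h ⊆ P(Δ)` of polynomials having a singular point near `t_h` are
smooth analytic hypersurfaces intersecting transversally: on a neighborhood `U'` of `P₀`
they are cut out by analytic submersions `φ_h`, and the joint differential of
`(φ₁, …, φ_N)` is surjective along the intersection. -/
theorem brusotti
    (L : Finset (ℕ × ℕ)) (hL : IsLatticePolytopeSet L)
    (N : ℕ) (P0 : Coef L) (t : Fin N → (Fin 2 → ℂ))
    (htinj : Function.Injective t)
    (hnodes : ∀ h, IsNodeAt (toPoly P0) (t h))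
    (honly : ∀ z : Fin 2 → ℂ, IsSingAt (toPoly P0) z → ∃ h, z = t h) :
    ∃ δ : ℝ, 0 < δ ∧ ∃ U' : Set (Coef L), IsOpen U' ∧ P0 ∈ U' ∧
      ∃ φ : Fin N → (Coef L → ℂ),
        (∀ h, AnalyticOnNhd ℂ (φ h) U') ∧
        -- `B'_h ∩ U'` is the zero set of `φ_h`:
        (∀ h, ∀ Q ∈ U', (φ h Q = 0 ↔
          ∃ z : Fin 2 → ℂ, dist z (t h) < δ ∧ IsSingAt (toPoly Q) z)) ∧
        -- each `B'_h` is smooth of codimension 1: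
        (∀ h, ∀ Q ∈ U', φ h Q = 0 → fderiv ℂ (φ h) Q ≠ 0) ∧
        -- and `B'_1 ∩ ⋯ ∩ B'_N ∩ U'` is a transversal intersection:
        (∀ Q ∈ U', (∀ h, φ h Q = 0) →
          Function.Surjective (fderiv ℂ (fun Q' => (fun h => φ h Q' : Fin N → ℂ)) Q)) := by
  choose φ hφ hdφ hzero using fun h => exists_local_equation (hnodes h)
  obtain ⟨δ, hδ, hδ0⟩ := ((Filter.eventually_all.2 hzero).and self_mem_nhdsWithin).exists
  have hanalytic : AnalyticAt ℂ (fun Q h => φ h Q) P0 := AnalyticAt.pi hφ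
  have hsurj0 : Function.Surjective (fderiv ℂ (fun Q h => φ h Q) P0) := by
    intro y
    obtain ⟨R, hR⟩ := surjective_eval_of_isNodeAt hL htinj hnodes y
    refine ⟨R, funext fun h => ?_⟩
    rw [← hR, ← hdφ, fderiv_pi fun h => (hφ h).differentiableAt]
    rfl
  have hsurj := hanalytic.fderiv.continuousAt.eventually
    (ContinuousLinearMap.eventually_surjective hsurj0)
  have hev := ((Filter.eventually_all.2 fun h => (hφ h).eventually_analyticAt).and
    (Filter.eventually_all.2 hδ)).and hsurj
  obtain ⟨U, hU, hUo, hPU⟩ := eventually_nhds_iff.1 hev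
  refine ⟨δ, hδ0, U, hUo, hPU, φ, fun h Q hQ => (hU Q hQ).1.1 h, fun h Q hQ => (hU Q hQ).1.2 h,
    fun h Q hQ _ h0 => ?_, fun Q hQ _ => (hU Q hQ).2⟩
  obtain ⟨R, hR⟩ := (hU Q hQ).2 (Pi.single h 1)
  rw [fderiv_pi fun h => ((hU Q hQ).1.1 h).differentiableAt] at hR
  have := congrFun hR h
  simp [h0] at this
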